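/- Let Ω ⊂ ℝ² be open and let v ∈ C(Ω) admit a distributional Burgers derivative Bv = g ∈ L∞_loc(Ω). Assume: (i) v minimizes the intrinsic area for compact perturbations, i.e. for every ṽ ∈ C(Ω) with distributional Burgers derivative Bṽ ∈ L∞_loc(Ω) and with spt(v − ṽ) compactly contained in Ω, one has ∫_K √(1 + (Bv)²) ≤ ∫_K √(1 + (Bṽ)²) for every compact K ⊂ Ω containing spt(v − ṽ); (ii) for every w₀ = (y₀,t₀) ∈ Ω there exists r > 0 with the closed disk of radius r about w₀ contained in Ω and lim_{ρ→0⁺} ρ·ℓ^v_r(ρ; w₀) = 0. Then v is locally Lipschitz in Ω, Bv coincides a.e. with a locally Lipschitz function on Ω (i.e. v ∈ C^{1,1}_{H,loc}(Ω)), and the left intrinsic graph S_v is foliated by horizontal straight segments: through every point p ∈ S_v there passes a nondegenerate open straight line segment contained in S_v whose direction vector lies in the horizontal plane H_p. -/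

import Mathlib

open Set MeasureTheory

noncomputable section

/-- The lens-shaped comparison domain
`D_{r,ρ}(w₀) = {(y₀+y, t₀+t-r) : t ∈ (0,2r), |y| < (ρ/r²)·t·(2r-t)}`. -/
def lensDr (w₀ : ℝ × ℝ) (r ρ : ℝ) : Set (ℝ × ℝ) :=
  {w | w.2 - w₀.2 + r ∈ Set.Ioo 0 (2 * r) ∧
    |w.1 - w₀.1| < ρ / r ^ 2 * (w.2 - w₀.2 + r) * (2 * r - (w.2 - w₀.2 + r))}

/-- The left intrinsic graph map `(y,t) ↦ (v(y,t), y, t + 2y·v(y,t))`. -/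
def graphMap (v : ℝ × ℝ → ℝ) (w : ℝ × ℝ) : ℝ × ℝ × ℝ :=
  (v w, w.1, w.2 + 2 * w.1 * v w)

open Filter Topology

/-- The area integrand lies below a parabola tangent to it at any point. -/
lemma sqrt_one_add_sq_add_le (x h : ℝ) :
    √(1 + (x + h) ^ 2) ≤ √(1 + x ^ 2) + x / √(1 + x ^ 2) * h + h ^ 2 / 2 := by
  set S := √(1 + x ^ 2) with hS
  have hS2 : S ^ 2 = 1 + x ^ 2 := Real.sq_sqrt (by positivity)
  have hS1 : 1 ≤ S := by rw [hS]; exact Real.one_le_sqrt.2 (by nlinarith)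
  have hS0 : 0 < S := by linarith
  have h1 : √(1 + (x + h) ^ 2) ≤ S + (2 * x * h + h ^ 2) / (2 * S) := by
    apply Real.sqrt_le_iff.2
    have e : S + (2 * x * h + h ^ 2) / (2 * S) = (1 + x ^ 2 + 1 + (x + h) ^ 2) / (2 * S) := by
      field_simp; nlinarith
    constructor
    · rw [e]; positivity
    · have e2 : (S + (2 * x * h + h ^ 2) / (2 * S)) ^ 2
          = 1 + (x + h) ^ 2 + ((2 * x * h + h ^ 2) / (2 * S)) ^ 2 := by
        have : 2 * S * ((2 * x * h + h ^ 2) / (2 * S)) = 2 * x * h + h ^ 2 := by field_simp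
        nlinarith
      rw [e2]; nlinarith [sq_nonneg ((2 * x * h + h ^ 2) / (2 * S))]
  have h2 : (2 * x * h + h ^ 2) / (2 * S) ≤ x / S * h + h ^ 2 / 2 := by
    have : (2 * x * h + h ^ 2) / (2 * S) = x / S * h + h ^ 2 / (2 * S) := by field_simp
    rw [this]
    gcongr
    linarith
  linarith

lemma abs_div_sqrt_le_one (x : ℝ) : |x / √(1 + x ^ 2)| ≤ 1 := by
  rw [abs_div, abs_of_nonneg (Real.sqrt_nonneg _)]
  apply div_le_one_of_le₀ _ (Real.sqrt_nonneg _)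
  exact Real.abs_le_sqrt (by linarith)

lemma eq_of_div_sqrt_eq {x k : ℝ} (h : x / √(1 + x ^ 2) = k) : x = k / √(1 - k ^ 2) := by
  have hS2 : √(1 + x ^ 2) ^ 2 = 1 + x ^ 2 := Real.sq_sqrt (by positivity)
  have hS0 : 0 < √(1 + x ^ 2) := Real.sqrt_pos.2 (by positivity)
  have e : 1 - k ^ 2 = (1 / √(1 + x ^ 2)) ^ 2 := by
    rw [← h, div_pow, div_pow, hS2]
    field_simp; ring
  rw [e, Real.sqrt_sq (by positivity), ← h]
  field_simp

lemma integral_lineDeriv_mul_eq_neg {V φ : ℝ × ℝ → ℝ} {L : NNReal} (hV : LipschitzWith L V)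
    (hφ : ContDiff ℝ 1 φ) (hc : HasCompactSupport φ) (e : ℝ × ℝ) :
    ∫ w, lineDeriv ℝ V w e * φ w = -∫ w, V w * fderiv ℝ φ w e := by
  obtain ⟨C, hC⟩ := hφ.lipschitzWith_of_hasCompactSupport hc one_ne_zero
  rw [hV.integral_lineDeriv_mul_eq hC hc e, ← integral_neg]
  congr 1; ext w
  rw [((hφ.differentiable one_ne_zero) w).lineDeriv_eq_fderiv, map_neg]
  ring

/-- Lebesgue differentiation on almost every vertical line. -/
lemma ae_hasDerivAt_vertical_primitive {f : ℝ × ℝ → ℝ} (hf : Measurable f) {C : ℝ}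
    (hC : ∀ w, |f w| ≤ C) :
    ∀ᵐ w : ℝ × ℝ, HasDerivAt (fun t => ∫ τ in (0:ℝ)..t, f (w.1, τ)) (f w) w.2 := by
  set P : ℝ × ℝ → ℝ := fun w => ∫ τ in (0:ℝ)..w.2, f (w.1, τ) with hP
  have hsec : ∀ y, Measurable fun τ => f (y, τ) := fun y => hf.comp measurable_prodMk_left
  have hfint : ∀ y a b, IntervalIntegrable (fun τ => f (y, τ)) volume a b := fun y a b =>
    (intervalIntegrable_const (c := C)).mono_fun (hsec y).aestronglyMeasurable
      (Eventually.of_forall fun τ => by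
        simpa [Real.norm_eq_abs] using (hC (y, τ)).trans (le_abs_self C))
  have hPcont : ∀ y, Continuous fun t => P (y, t) := by
    intro y
    exact intervalIntegral.continuous_primitive (hfint y) 0
  have hPmeas : Measurable P := by
    have h1 : StronglyMeasurable fun w : ℝ × ℝ => ∫ τ in Set.Ioc 0 w.2, f (w.1, τ) := by
      have : StronglyMeasurable fun p : (ℝ × ℝ) × ℝ =>
          (Set.indicator {p : (ℝ × ℝ) × ℝ | 0 < p.2 ∧ p.2 ≤ p.1.2}
            (fun p => f (p.1.1, p.2)) p) := by
        apply Measurable.stronglyMeasurable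
        apply Measurable.indicator
        · fun_prop
        · exact (measurableSet_lt measurable_const measurable_snd).inter
            (measurableSet_le measurable_snd (measurable_snd.comp measurable_fst))
      convert this.integral_prod_right' (ν := volume) using 2 with w
      rw [← integral_indicator measurableSet_Ioc]
      rfl
    have h2 : StronglyMeasurable fun w : ℝ × ℝ => ∫ τ in Set.Ioc w.2 0, f (w.1, τ) := by
      have : StronglyMeasurable fun p : (ℝ × ℝ) × ℝ =>
          (Set.indicator {p : (ℝ × ℝ) × ℝ | p.1.2 < p.2 ∧ p.2 ≤ 0}
            (fun p => f (p.1.1, p.2)) p) := by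
        apply Measurable.stronglyMeasurable
        apply Measurable.indicator
        · fun_prop
        · exact (measurableSet_lt (measurable_snd.comp measurable_fst) measurable_snd).inter
            (measurableSet_le measurable_snd measurable_const)
      convert this.integral_prod_right' (ν := volume) using 2 with w
      rw [← integral_indicator measurableSet_Ioc]
      rfl
    exact (h1.sub h2).measurable
  set G : Set (ℝ × ℝ) := ⋂ n : ℕ, ⋃ m : ℕ, ⋂ h : ℚ, {w | |(h:ℝ)| < 1 / ((m:ℝ) + 1) →
    |P (w.1, w.2 + h) - P w - h * f w| ≤ |(h:ℝ)| / ((n:ℝ) + 1)} with hG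
  have hGm : MeasurableSet G := by
    refine MeasurableSet.iInter fun n => MeasurableSet.iUnion fun m =>
      MeasurableSet.iInter fun h => ?_
    by_cases hh : |(h:ℝ)| < 1 / ((m:ℝ) + 1)
    · simp only [hh, true_imp_iff]
      refine measurableSet_le ?_ measurable_const
      have : Measurable fun w : ℝ × ℝ => P (w.1, w.2 + h) := hPmeas.comp (by fun_prop)
      fun_prop
    · simp only [hh, false_imp_iff]
      exact MeasurableSet.univ
  have hiff : ∀ w, w ∈ G ↔ HasDerivAt (fun t => P (w.1, t)) (f w) w.2 := by
    intro w
    rw [hasDerivAt_iff_isLittleO_nhds_zero, Asymptotics.isLittleO_iff]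
    simp only [hG, mem_iInter, mem_iUnion, mem_ofPred_eq, smul_eq_mul, Real.norm_eq_abs]
    constructor
    · intro hw c hc
      obtain ⟨n, hn⟩ := exists_nat_one_div_lt hc
      obtain ⟨m, hm⟩ := hw n
      have hpos : (0:ℝ) < 1 / ((m:ℝ) + 1) := by positivity
      filter_upwards [Metric.ball_mem_nhds (0:ℝ) hpos] with h hh
      have hh' : |h| < 1 / ((m:ℝ) + 1) := by simpa using hh
      have key : |P (w.1, w.2 + h) - P w - h * f w| ≤ |h| / ((n:ℝ) + 1) := by
        have hcl : IsClosed {h : ℝ | |P (w.1, w.2 + h) - P w - h * f w| ≤ |h| / ((n:ℝ) + 1)} := by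
          have := hPcont w.1
          have h1 : Continuous fun h => P (w.1, w.2 + h) := this.comp (by fun_prop)
          exact isClosed_le (((h1.sub continuous_const).sub
            (continuous_id.mul continuous_const)).abs) (by fun_prop)
        have hd : h ∈ closure ({h : ℝ | |h| < 1 / ((m:ℝ) + 1)} ∩ Set.range ((↑) : ℚ → ℝ)) := by
          have ho : IsOpen {h : ℝ | |h| < 1 / ((m:ℝ) + 1)} :=
            isOpen_lt continuous_abs continuous_const
          exact Rat.denseRange_cast.open_subset_closure_inter ho hh'
        refine hcl.closure_subset_iff.2 ?_ hd
        rintro _ ⟨h1, q, rfl⟩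
        exact hm q h1
      refine key.trans ?_
      rw [div_eq_mul_one_div, mul_comm]
      gcongr
    · intro hw n
      have hc : (0:ℝ) < 1 / ((n:ℝ) + 1) := by positivity
      obtain ⟨ε, hε, hb⟩ := Metric.eventually_nhds_iff.1 (hw hc)
      obtain ⟨m, hm⟩ := exists_nat_one_div_lt hε
      refine ⟨m, fun h hh => ?_⟩
      have := hb (y := (h:ℝ)) (by rw [dist_zero_right]; exact hh.trans hm)
      rw [div_eq_mul_one_div, mul_comm |(h:ℝ)|]
      exact this
  have : ∀ᵐ w : ℝ × ℝ, w ∈ G := by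
    rw [Measure.volume_eq_prod, ae_iff]
    have : {a | ¬ a ∈ G} = Gᶜ := rfl
    rw [this, Measure.measure_prod_null hGm.compl]
    refine Eventually.of_forall fun y => ?_
    have hl : LocallyIntegrable (fun τ => f (y, τ)) volume :=
      ((memLp_top_of_bound (hsec y).aestronglyMeasurable C
        (Eventually.of_forall fun τ => hC _)).locallyIntegrable le_top)
    have := _root_.LocallyIntegrable.ae_hasDerivAt_integral hl
    have h2 : ∀ᵐ t : ℝ, (y, t) ∈ G := by
      filter_upwards [this] with t ht
      exact (hiff (y, t)).2 (ht 0)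
    exact h2
  filter_upwards [this] with w hw
  exact (hiff w).1 hw

/-- A continuous function with locally bounded distributional Burgers derivative `g` which minimizes
the intrinsic area among compact perturbations. -/
structure BurgersMinimizer (Ω : Set (ℝ × ℝ)) (v g : ℝ × ℝ → ℝ) : Prop where
  isOpen : IsOpen Ω
  continuousOn : ContinuousOn v Ω
  aestronglyMeasurable : AEStronglyMeasurable g (volume.restrict Ω)
  bounded : ∀ K : Set (ℝ × ℝ), IsCompact K → K ⊆ Ω →
      ∃ M : ℝ, ∀ᵐ w ∂(volume.restrict K), |g w| ≤ M
  integral_eq : ∀ ψ : ℝ × ℝ → ℝ, ContDiff ℝ (⊤ : ℕ∞) ψ → HasCompactSupport ψ →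
      tsupport ψ ⊆ Ω →
      ∫ w in Ω, g w * ψ w =
        -∫ w in Ω, (v w * fderiv ℝ ψ w (1, 0) - 2 * (v w) ^ 2 * fderiv ℝ ψ w (0, 1))
  minimal : ∀ vt gt : ℝ × ℝ → ℝ, ContinuousOn vt Ω →
      AEStronglyMeasurable gt (volume.restrict Ω) →
      (∀ K : Set (ℝ × ℝ), IsCompact K → K ⊆ Ω →
        ∃ M : ℝ, ∀ᵐ w ∂(volume.restrict K), |gt w| ≤ M) →
      (∀ ψ : ℝ × ℝ → ℝ, ContDiff ℝ (⊤ : ℕ∞) ψ → HasCompactSupport ψ →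
        tsupport ψ ⊆ Ω →
        ∫ w in Ω, gt w * ψ w =
          -∫ w in Ω,
            (vt w * fderiv ℝ ψ w (1, 0) - 2 * (vt w) ^ 2 * fderiv ℝ ψ w (0, 1))) →
      IsCompact (closure (Function.support fun w => v w - vt w)) →
      closure (Function.support fun w => v w - vt w) ⊆ Ω →
      ∀ K : Set (ℝ × ℝ), IsCompact K → K ⊆ Ω →
        (Function.support fun w => v w - vt w) ⊆ K →
        ∫ w in K, Real.sqrt (1 + (g w) ^ 2) ≤ ∫ w in K, Real.sqrt (1 + (gt w) ^ 2)

/-- The derivative at `V` of the Burgers operator in the direction `φ`. -/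
def firstVariation (V φ : ℝ × ℝ → ℝ) (w : ℝ × ℝ) : ℝ :=
  fderiv ℝ φ w (1, 0) - 4 * (V w * fderiv ℝ φ w (0, 1) + lineDeriv ℝ V w (0, 1) * φ w)

lemma measurable_bounded_mul_integrable {f φ : ℝ × ℝ → ℝ} (hf : Measurable f) {C : ℝ}
    (hC : ∀ w, |f w| ≤ C) (hφ : Continuous φ) (hc : HasCompactSupport φ) :
    Integrable fun w => f w * φ w :=
  (hφ.integrable_of_hasCompactSupport hc).bdd_mul hf.aestronglyMeasurable
    (c := C) (Eventually.of_forall hC)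

lemma abs_lineDeriv_vertical_le {V : ℝ × ℝ → ℝ} {L : NNReal} (hV : LipschitzWith L V)
    (w : ℝ × ℝ) : |lineDeriv ℝ V w (0, 1)| ≤ L := by
  have := norm_lineDeriv_le_of_lipschitz ℝ (x₀ := w) (v := ((0, 1) : ℝ × ℝ)) hV
  simpa [Prod.norm_def] using this

lemma abs_lineDeriv_horizontal_le {V : ℝ × ℝ → ℝ} {L : NNReal} (hV : LipschitzWith L V)
    (w : ℝ × ℝ) : |lineDeriv ℝ V w (1, 0)| ≤ L := by
  have := norm_lineDeriv_le_of_lipschitz ℝ (x₀ := w) (v := ((1, 0) : ℝ × ℝ)) hV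
  simpa [Prod.norm_def] using this

lemma fderiv_eq_zero_of_notMem_tsupport {φ : ℝ × ℝ → ℝ} {w : ℝ × ℝ} (hw : w ∉ tsupport φ) :
    fderiv ℝ φ w = 0 := by
  by_contra h
  exact hw (support_fderiv_subset ℝ h)

lemma firstVariation_eq_zero {V φ : ℝ × ℝ → ℝ} {w : ℝ × ℝ} (hw : w ∉ tsupport φ) :
    firstVariation V φ w = 0 := by
  simp [firstVariation, fderiv_eq_zero_of_notMem_tsupport hw, image_eq_zero_of_notMem_tsupport hw]

section
variable {V φ : ℝ × ℝ → ℝ} {L : NNReal}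

lemma measurable_firstVariation (hV : LipschitzWith L V) (hφ : ContDiff ℝ 1 φ) :
    Measurable (firstVariation V φ) := by
  have h1 : Measurable fun w => fderiv ℝ φ w (1, 0) := measurable_fderiv_apply_const ℝ φ _
  have h2 : Measurable fun w => fderiv ℝ φ w (0, 1) := measurable_fderiv_apply_const ℝ φ _
  have h3 := measurable_lineDeriv (𝕜 := ℝ) (v := ((0, 1) : ℝ × ℝ)) hV.continuous
  have h4 := hV.continuous.measurable
  have h5 := hφ.continuous.measurable
  exact h1.sub (((h4.mul h2).add (h3.mul h5)).const_mul 4)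

lemma exists_bound_of_compactSupport {f : ℝ × ℝ → ℝ} (hf : Continuous f)
    (hc : HasCompactSupport f) : ∃ C, ∀ w, |f w| ≤ C :=
  hf.bounded_above_of_compact_support hc

lemma continuous_fderiv_apply_of_contDiff (hφ : ContDiff ℝ 1 φ) (e : ℝ × ℝ) :
    Continuous fun w => fderiv ℝ φ w e :=
  (hφ.continuous_fderiv one_ne_zero).clm_apply continuous_const

lemma exists_bound_firstVariation (hV : LipschitzWith L V) (hφ : ContDiff ℝ 1 φ)
    (hc : HasCompactSupport φ) : ∃ C, 0 ≤ C ∧ ∀ w, |firstVariation V φ w| ≤ C := by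
  obtain ⟨C1, h1⟩ := exists_bound_of_compactSupport (continuous_fderiv_apply_of_contDiff hφ (1, 0))
    (hc.fderiv_apply ℝ _)
  obtain ⟨C2, h2⟩ := exists_bound_of_compactSupport (f := fun w => V w * fderiv ℝ φ w (0, 1))
    (hV.continuous.mul (continuous_fderiv_apply_of_contDiff hφ (0, 1)))
    ((hc.fderiv_apply ℝ _).mul_left)
  obtain ⟨C3, h3⟩ := exists_bound_of_compactSupport hφ.continuous hc
  have h0 : ∀ w, |firstVariation V φ w| ≤ C1 + 4 * (C2 + L * C3) := by
    intro w
    have a1 := h1 w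
    have a2 := h2 w
    have a3 : |lineDeriv ℝ V w (0, 1) * φ w| ≤ L * C3 := by
      rw [abs_mul]
      exact mul_le_mul (abs_lineDeriv_vertical_le hV w) (h3 w) (abs_nonneg _) L.2
    rw [abs_le] at *
    unfold firstVariation
    constructor <;> linarith [a1.1, a1.2, a2.1, a2.2, a3.1, a3.2]
  exact ⟨_, (abs_nonneg _).trans (h0 0), h0⟩

lemma integral_variation_mul (hV : LipschitzWith L V) (hφ : ContDiff ℝ 1 φ)
    (hc : HasCompactSupport φ) {ψ : ℝ × ℝ → ℝ} (hψ : ContDiff ℝ 1 ψ) (hψc : HasCompactSupport ψ)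
    (ε : ℝ) :
    ∫ w, (ε * firstVariation V φ w - 4 * ε ^ 2 * (φ w * fderiv ℝ φ w (0, 1))) * ψ w =
    -∫ w, (ε * φ w * fderiv ℝ ψ w (1, 0) -
      2 * (2 * ε * V w * φ w + ε ^ 2 * φ w ^ 2) * fderiv ℝ ψ w (0, 1)) := by
  obtain ⟨C, hC⟩ := hφ.lipschitzWith_of_hasCompactSupport hc one_ne_zero
  have hφ2 : ContDiff ℝ 1 fun w => φ w ^ 2 := hφ.pow 2
  have hc2 : HasCompactSupport fun w => φ w ^ 2 := hc.comp_left (g := fun x : ℝ => x ^ 2) (by simp)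
  obtain ⟨C2, hC2⟩ := hφ2.lipschitzWith_of_hasCompactSupport hc2 one_ne_zero
  have hd : ∀ w, DifferentiableAt ℝ φ w := hφ.differentiable one_ne_zero
  have hdψ : ∀ w, DifferentiableAt ℝ ψ w := hψ.differentiable one_ne_zero
  have I1 := integral_lineDeriv_mul_eq_neg hC hψ hψc (1, 0)
  have I2 := integral_lineDeriv_mul_eq_neg hV (hφ.mul hψ) hψc.mul_left (0, 1)
  have I3 := integral_lineDeriv_mul_eq_neg hC2 hψ hψc (0, 1)
  have e1 : ∀ w, lineDeriv ℝ φ w (1, 0) = fderiv ℝ φ w (1, 0) :=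
    fun w => (hd w).lineDeriv_eq_fderiv
  have e3 : ∀ w, lineDeriv ℝ (fun w => φ w ^ 2) w (0, 1) = 2 * φ w * fderiv ℝ φ w (0, 1) := by
    intro w
    rw [((hd w).fun_pow 2).lineDeriv_eq_fderiv, fderiv_fun_pow _ (hd w)]
    simp
  have e2 : ∀ w, fderiv ℝ (fun w => φ w * ψ w) w (0, 1) =
      φ w * fderiv ℝ ψ w (0, 1) + ψ w * fderiv ℝ φ w (0, 1) := by
    intro w
    rw [fderiv_fun_mul (hd w) (hdψ w)]
    simp
  simp only [e1] at I1
  simp only [e3] at I3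
  simp only [e2] at I2
  have c1 := continuous_fderiv_apply_of_contDiff hφ (1, 0)
  have c2 := continuous_fderiv_apply_of_contDiff hφ (0, 1)
  have c3 := continuous_fderiv_apply_of_contDiff hψ (1, 0)
  have c4 := continuous_fderiv_apply_of_contDiff hψ (0, 1)
  have cφ := hφ.continuous
  have cψ := hψ.continuous
  have cV := hV.continuous
  have J1 : Integrable fun w => fderiv ℝ φ w (1, 0) * ψ w :=
    (c1.mul cψ).integrable_of_hasCompactSupport hψc.mul_left
  have J2 : Integrable fun w => lineDeriv ℝ V w (0, 1) * (φ w * ψ w) :=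
    measurable_bounded_mul_integrable (measurable_lineDeriv cV) (abs_lineDeriv_vertical_le hV)
      (cφ.mul cψ) hψc.mul_left
  have J3 : Integrable fun w => 2 * φ w * fderiv ℝ φ w (0, 1) * ψ w :=
    Continuous.integrable_of_hasCompactSupport (by fun_prop) hψc.mul_left
  have J4 : Integrable fun w => V w * (ψ w * fderiv ℝ φ w (0, 1)) :=
    Continuous.integrable_of_hasCompactSupport (by fun_prop) (hψc.mul_right.mul_left)
  have J5 : Integrable fun w => V w * (φ w * fderiv ℝ ψ w (0, 1)) :=
    Continuous.integrable_of_hasCompactSupport (by fun_prop) (hc.mul_right.mul_left)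
  have J6 : Integrable fun w => φ w * fderiv ℝ ψ w (1, 0) :=
    Continuous.integrable_of_hasCompactSupport (by fun_prop) hc.mul_right
  have J7 : Integrable fun w => φ w ^ 2 * fderiv ℝ ψ w (0, 1) :=
    Continuous.integrable_of_hasCompactSupport (by fun_prop) hc2.mul_right
  have l : ∀ w, (ε * firstVariation V φ w - 4 * ε ^ 2 * (φ w * fderiv ℝ φ w (0, 1))) * ψ w =
      ε * (fderiv ℝ φ w (1, 0) * ψ w) - 4 * ε * (V w * (ψ w * fderiv ℝ φ w (0, 1)))
      - 4 * ε * (lineDeriv ℝ V w (0, 1) * (φ w * ψ w))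
      - 2 * ε ^ 2 * (2 * φ w * fderiv ℝ φ w (0, 1) * ψ w) := by
    intro w; unfold firstVariation; ring
  have r : ∀ w, (ε * φ w * fderiv ℝ ψ w (1, 0) -
      2 * (2 * ε * V w * φ w + ε ^ 2 * φ w ^ 2) * fderiv ℝ ψ w (0, 1)) =
      ε * (φ w * fderiv ℝ ψ w (1, 0)) - 4 * ε * (V w * (φ w * fderiv ℝ ψ w (0, 1)))
      - 2 * ε ^ 2 * (φ w ^ 2 * fderiv ℝ ψ w (0, 1)) := by
    intro w; ring
  simp only [l, r]
  simp only [mul_add] at I2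
  rw [integral_add J5 J4] at I2
  rw [integral_sub (((J1.const_mul _).sub' (J4.const_mul _)).sub' (J2.const_mul _))
      (J3.const_mul _),
    integral_sub ((J1.const_mul _).sub' (J4.const_mul _)) (J2.const_mul _),
    integral_sub (J1.const_mul _) (J4.const_mul _),
    integral_sub ((J6.const_mul _).sub' (J5.const_mul _)) (J7.const_mul _),
    integral_sub (J6.const_mul _) (J5.const_mul _)]
  simp only [integral_const_mul]
  rw [I1, I2, I3]
  ring
end

lemma eq_zero_of_forall_quadratic_nonneg {I D : ℝ}
    (h : ∀ ε : ℝ, |ε| ≤ 1 → 0 ≤ ε * I + ε ^ 2 * D) : I = 0 := by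
  by_contra hI
  have hD : 0 < |D| + |I| := by positivity
  have hI0 : 0 < |I| := abs_pos.2 hI
  set ε := -I / (2 * (|D| + |I|)) with hε
  have h1 : |ε| ≤ 1 := by
    rw [hε, abs_div, abs_neg, abs_of_pos (by positivity : 0 < 2 * (|D| + |I|))]
    rw [div_le_one (by positivity)]
    linarith [abs_nonneg D]
  have h2 := h ε h1
  have h3 : ε * (2 * (|D| + |I|)) = -I := by rw [hε]; field_simp
  have h4 : ε ^ 2 * D ≤ ε ^ 2 * (|D| + |I|) := by
    apply mul_le_mul_of_nonneg_left _ (sq_nonneg _)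
    linarith [le_abs_self D]
  have h5 : ε ^ 2 * (|D| + |I|) = - (ε * I) / 2 := by
    have : ε ^ 2 * (|D| + |I|) = ε * (ε * (2 * (|D| + |I|))) / 2 := by ring
    rw [this, h3]; ring
  have h6 : 0 ≤ ε * I := by linarith
  have h7 : ε * I * (2 * (|D| + |I|)) = - I ^ 2 := by
    calc _ = ε * (2 * (|D| + |I|)) * I := by ring
      _ = _ := by rw [h3]; ring
  have : 0 < I ^ 2 := by positivity
  nlinarith

namespace BurgersMinimizer
variable {Ω U : Set (ℝ × ℝ)} {v g V φ : ℝ × ℝ → ℝ} {L : NNReal}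

lemma integrable_mul_test (H : BurgersMinimizer Ω v g) {ψ : ℝ × ℝ → ℝ} (hψ : Continuous ψ)
    (hc : HasCompactSupport ψ) (hs : tsupport ψ ⊆ Ω) :
    IntegrableOn (fun w => g w * ψ w) Ω := by
  have hK : IsCompact (tsupport ψ) := hc
  obtain ⟨M, hM⟩ := H.bounded _ hK hs
  have : IntegrableOn (fun w => g w * ψ w) (tsupport ψ) := by
    have h1 : IntegrableOn ψ (tsupport ψ) := hψ.continuousOn.integrableOn_compact hK
    exact h1.bdd_mul (c := M)
      (H.aestronglyMeasurable.mono_measure (Measure.restrict_mono hs le_rfl)) hM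
  refine this.of_forall_sdiff_eq_zero H.isOpen.measurableSet fun w hw => ?_
  rw [image_eq_zero_of_notMem_tsupport hw.2, mul_zero]

lemma integrable_flux_test (H : BurgersMinimizer Ω v g) {ψ : ℝ × ℝ → ℝ} (hψ : ContDiff ℝ 1 ψ)
    (hc : HasCompactSupport ψ) (hs : tsupport ψ ⊆ Ω) :
    IntegrableOn (fun w => v w * fderiv ℝ ψ w (1, 0) - 2 * (v w) ^ 2 * fderiv ℝ ψ w (0, 1)) Ω := by
  have hK : IsCompact (tsupport ψ) := hc
  have : IntegrableOn (fun w => v w * fderiv ℝ ψ w (1, 0) - 2 * (v w) ^ 2 * fderiv ℝ ψ w (0, 1))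
      (tsupport ψ) := by
    apply ContinuousOn.integrableOn_compact hK
    have hv := H.continuousOn.mono hs
    have c1 := (continuous_fderiv_apply_of_contDiff hψ (1, 0)).continuousOn (s := tsupport ψ)
    have c2 := (continuous_fderiv_apply_of_contDiff hψ (0, 1)).continuousOn (s := tsupport ψ)
    fun_prop
  refine this.of_forall_sdiff_eq_zero H.isOpen.measurableSet fun w hw => ?_
  simp [fderiv_eq_zero_of_notMem_tsupport hw.2]

/-- Comparison of the area of a minimizer with that of `v + ε φ`. -/
lemma integral_le_perturbation (H : BurgersMinimizer Ω v g) (hUΩ : U ⊆ Ω)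
    (hV : LipschitzWith L V) (hVv : ∀ w ∈ U, V w = v w) (hφ : ContDiff ℝ 1 φ)
    (hc : HasCompactSupport φ) (hs : tsupport φ ⊆ U) (ε : ℝ) :
    ∫ w in tsupport φ, √(1 + g w ^ 2) ≤ ∫ w in tsupport φ,
      √(1 + (g w + (ε * firstVariation V φ w - 4 * ε ^ 2 * (φ w * fderiv ℝ φ w (0, 1)))) ^ 2) := by
  have hsΩ : tsupport φ ⊆ Ω := hs.trans hUΩ
  have hK : IsCompact (tsupport φ) := hc
  have hsub : (Function.support fun w => v w - (v w + ε * φ w)) ⊆ tsupport φ := by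
    intro w hw
    by_contra h
    apply hw
    simp [image_eq_zero_of_notMem_tsupport h]
  have hclos := closure_minimal hsub (isClosed_tsupport φ)
  have cB : Continuous fun w => φ w * fderiv ℝ φ w (0, 1) :=
    hφ.continuous.mul (continuous_fderiv_apply_of_contDiff hφ (0, 1))
  have mh : Measurable fun w =>
      ε * firstVariation V φ w - 4 * ε ^ 2 * (φ w * fderiv ℝ φ w (0, 1)) :=
    ((measurable_firstVariation hV hφ).const_mul _).sub (cB.measurable.const_mul _)
  obtain ⟨CA, -, hCA⟩ := exists_bound_firstVariation hV hφ hc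
  obtain ⟨CB, hCB⟩ := exists_bound_of_compactSupport cB hc.mul_right
  have bh : ∀ w, |ε * firstVariation V φ w - 4 * ε ^ 2 * (φ w * fderiv ℝ φ w (0, 1))| ≤
      |ε| * CA + 4 * ε ^ 2 * CB := by
    intro w
    refine (abs_sub _ _).trans ?_
    rw [abs_mul, abs_mul (4 * ε ^ 2), abs_of_nonneg (by positivity : 0 ≤ 4 * ε ^ 2)]
    gcongr
    · exact hCA w
    · exact hCB w
  refine H.minimal (fun w => v w + ε * φ w)
    (fun w => g w + (ε * firstVariation V φ w - 4 * ε ^ 2 * (φ w * fderiv ℝ φ w (0, 1))))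
    (H.continuousOn.add (hφ.continuous.const_smul ε).continuousOn)
    (H.aestronglyMeasurable.add mh.aestronglyMeasurable) ?_ ?_
    (hK.of_isClosed_subset isClosed_closure hclos) (hclos.trans hsΩ) _ hK hsΩ hsub
  · intro K hK hKΩ
    obtain ⟨M, hM⟩ := H.bounded K hK hKΩ
    refine ⟨M + (|ε| * CA + 4 * ε ^ 2 * CB), ?_⟩
    filter_upwards [hM] with w hw
    exact (abs_add_le _ _).trans (add_le_add hw (bh w))
  · intro ψ hψ hψc hψs
    have hψ1 : ContDiff ℝ 1 ψ := hψ.of_le (by exact_mod_cast le_top)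
    have key := integral_variation_mul hV hφ hc hψ1 hψc ε
    have i1 := H.integrable_mul_test hψ.continuous hψc hψs
    have i2 := measurable_bounded_mul_integrable mh bh hψ.continuous hψc
    have i3 := H.integrable_flux_test hψ1 hψc hψs
    have cV := hV.continuous
    have c3 := continuous_fderiv_apply_of_contDiff hψ1 (1, 0)
    have c4 := continuous_fderiv_apply_of_contDiff hψ1 (0, 1)
    have cφ := hφ.continuous
    have i4 : Integrable fun w => ε * φ w * fderiv ℝ ψ w (1, 0) -
      2 * (2 * ε * V w * φ w + ε ^ 2 * φ w ^ 2) * fderiv ℝ ψ w (0, 1) := by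
      apply Continuous.integrable_of_hasCompactSupport (by fun_prop)
      refine hc.mono fun w hw => ?_
      by_contra h
      apply hw
      have : φ w = 0 := by simpa using h
      simp [this]
    have s1 : ∫ w in Ω, (ε * firstVariation V φ w - 4 * ε ^ 2 * (φ w * fderiv ℝ φ w (0, 1))) * ψ w
        = ∫ w, (ε * firstVariation V φ w - 4 * ε ^ 2 * (φ w * fderiv ℝ φ w (0, 1))) * ψ w := by
      apply setIntegral_eq_integral_of_forall_compl_eq_zero
      intro w hw
      have : w ∉ tsupport φ := fun h => hw (hsΩ h)
      simp [firstVariation_eq_zero this, image_eq_zero_of_notMem_tsupport this]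
    have s2 : ∫ w in Ω, (ε * φ w * fderiv ℝ ψ w (1, 0) -
        2 * (2 * ε * V w * φ w + ε ^ 2 * φ w ^ 2) * fderiv ℝ ψ w (0, 1))
        = ∫ w, (ε * φ w * fderiv ℝ ψ w (1, 0) -
        2 * (2 * ε * V w * φ w + ε ^ 2 * φ w ^ 2) * fderiv ℝ ψ w (0, 1)) := by
      apply setIntegral_eq_integral_of_forall_compl_eq_zero
      intro w hw
      have : w ∉ tsupport φ := fun h => hw (hsΩ h)
      simp [image_eq_zero_of_notMem_tsupport this]
    have l : ∫ w in Ω, (g w + (ε * firstVariation V φ w -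
          4 * ε ^ 2 * (φ w * fderiv ℝ φ w (0, 1)))) * ψ w =
        (∫ w in Ω, g w * ψ w) + ∫ w in Ω, (ε * firstVariation V φ w -
          4 * ε ^ 2 * (φ w * fderiv ℝ φ w (0, 1))) * ψ w := by
      rw [← integral_add i1 i2.integrableOn]
      simp only [add_mul]
    have r : ∫ w in Ω, ((v w + ε * φ w) * fderiv ℝ ψ w (1, 0) -
          2 * (v w + ε * φ w) ^ 2 * fderiv ℝ ψ w (0, 1)) =
        (∫ w in Ω, (v w * fderiv ℝ ψ w (1, 0) - 2 * (v w) ^ 2 * fderiv ℝ ψ w (0, 1))) +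
        ∫ w in Ω, (ε * φ w * fderiv ℝ ψ w (1, 0) -
        2 * (2 * ε * V w * φ w + ε ^ 2 * φ w ^ 2) * fderiv ℝ ψ w (0, 1)) := by
      rw [← integral_add i3 i4.integrableOn]
      congr 1; ext w
      by_cases hw : w ∈ tsupport φ
      · rw [hVv w (hs hw)]; ring
      · simp [image_eq_zero_of_notMem_tsupport hw]
    rw [l, r, H.integral_eq ψ hψ hψc hψs, s1, s2, key]
    ring

/-- The weak Euler-Lagrange equation of the intrinsic area. -/
theorem euler_lagrange (H : BurgersMinimizer Ω v g) (hUΩ : U ⊆ Ω)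
    (hV : LipschitzWith L V) (hVv : ∀ w ∈ U, V w = v w) (hφ : ContDiff ℝ 1 φ)
    (hc : HasCompactSupport φ) (hs : tsupport φ ⊆ U) :
    ∫ w in Ω, g w / √(1 + g w ^ 2) * firstVariation V φ w = 0 := by
  have hsΩ : tsupport φ ⊆ Ω := hs.trans hUΩ
  have hK : IsCompact (tsupport φ) := hc
  set K := tsupport φ with hKdef
  have gm : AEStronglyMeasurable g (volume.restrict K) :=
    H.aestronglyMeasurable.mono_measure (Measure.restrict_mono hsΩ le_rfl)
  obtain ⟨M, hM⟩ := H.bounded _ hK hsΩ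
  have cB : Continuous fun w => φ w * fderiv ℝ φ w (0, 1) :=
    hφ.continuous.mul (continuous_fderiv_apply_of_contDiff hφ (0, 1))
  have mA := measurable_firstVariation hV hφ
  obtain ⟨CA, hCA0, hCA⟩ := exists_bound_firstVariation hV hφ hc
  obtain ⟨CB, hCB⟩ := exists_bound_of_compactSupport cB hc.mul_right
  have hCB0 : 0 ≤ CB := (abs_nonneg _).trans (hCB 0)
  have : IsFiniteMeasure (volume.restrict K) := ⟨by simpa using hK.measure_lt_top⟩
  have qm : AEStronglyMeasurable (fun w => g w / √(1 + g w ^ 2)) (volume.restrict K) := by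
    have : Continuous fun x : ℝ => x / √(1 + x ^ 2) := by
      refine continuous_id.div (by fun_prop) fun x => (Real.sqrt_pos.2 (by positivity)).ne'
    exact this.comp_aestronglyMeasurable gm
  have sm : AEStronglyMeasurable (fun w => √(1 + g w ^ 2)) (volume.restrict K) :=
    (show Continuous fun x : ℝ => √(1 + x ^ 2) by fun_prop).comp_aestronglyMeasurable gm
  have i0 : Integrable (fun w => √(1 + g w ^ 2)) (volume.restrict K) := by
    refine Integrable.of_bound sm (√(1 + M ^ 2)) ?_
    filter_upwards [hM] with w hw
    rw [Real.norm_eq_abs, abs_of_nonneg (Real.sqrt_nonneg _)]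
    apply Real.sqrt_le_sqrt
    have := sq_le_sq' (abs_le.1 hw).1 (abs_le.1 hw).2
    linarith
  have iA : Integrable (fun w => g w / √(1 + g w ^ 2) * firstVariation V φ w)
      (volume.restrict K) :=
    (Integrable.of_bound mA.aestronglyMeasurable CA (Eventually.of_forall hCA)).bdd_mul (c := 1) qm
      (Eventually.of_forall fun w => abs_div_sqrt_le_one _)
  have iB : Integrable (fun w => g w / √(1 + g w ^ 2) * (φ w * fderiv ℝ φ w (0, 1)))
      (volume.restrict K) :=
    (Integrable.of_bound cB.aestronglyMeasurable CB (Eventually.of_forall hCB)).bdd_mul (c := 1) qm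
      (Eventually.of_forall fun w => abs_div_sqrt_le_one _)
  have hres : ∫ w in Ω, g w / √(1 + g w ^ 2) * firstVariation V φ w =
      ∫ w in K, g w / √(1 + g w ^ 2) * firstVariation V φ w := by
    refine setIntegral_eq_of_subset_of_forall_sdiff_eq_zero H.isOpen.measurableSet hsΩ
      fun w hw => ?_
    rw [firstVariation_eq_zero hw.2, mul_zero]
  rw [hres]
  set C := CA + 4 * CB with hC
  refine eq_zero_of_forall_quadratic_nonneg
    (D := C ^ 2 / 2 * volume.real K
      - 4 * ∫ w in K, g w / √(1 + g w ^ 2) * (φ w * fderiv ℝ φ w (0, 1))) fun ε hε => ?_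
  have hmin := H.integral_le_perturbation hUΩ hV hVv hφ hc hs ε
  have i1 : Integrable (fun w => √(1 + g w ^ 2) + (ε * (g w / √(1 + g w ^ 2) * firstVariation V φ w)
      - 4 * ε ^ 2 * (g w / √(1 + g w ^ 2) * (φ w * fderiv ℝ φ w (0, 1))))
      + ε ^ 2 * (C ^ 2 / 2)) (volume.restrict K) :=
    (i0.add ((iA.const_mul _).sub (iB.const_mul _))).add (integrable_const _)
  have hle : ∫ w in K, √(1 + (g w + (ε * firstVariation V φ w
        - 4 * ε ^ 2 * (φ w * fderiv ℝ φ w (0, 1)))) ^ 2) ≤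
      ∫ w in K, (√(1 + g w ^ 2) + (ε * (g w / √(1 + g w ^ 2) * firstVariation V φ w)
      - 4 * ε ^ 2 * (g w / √(1 + g w ^ 2) * (φ w * fderiv ℝ φ w (0, 1))))
      + ε ^ 2 * (C ^ 2 / 2)) := by
    refine integral_mono_of_nonneg (Eventually.of_forall fun w => Real.sqrt_nonneg _) i1
      (Eventually.of_forall fun w => ?_)
    refine (sqrt_one_add_sq_add_le _ _).trans ?_
    have hb : |ε * firstVariation V φ w - 4 * ε ^ 2 * (φ w * fderiv ℝ φ w (0, 1))| ≤ |ε| * C := by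
      refine (abs_sub _ _).trans ?_
      rw [abs_mul, abs_mul (4 * ε ^ 2), abs_of_nonneg (by positivity : 0 ≤ 4 * ε ^ 2), hC, mul_add]
      have h1 : ε ^ 2 ≤ |ε| := by
        rw [← sq_abs]; nlinarith [abs_nonneg ε]
      have h2 := hCA w
      have h3 := hCB w
      have := mul_le_mul_of_nonneg_left h2 (abs_nonneg ε)
      have : 4 * ε ^ 2 * |φ w * fderiv ℝ φ w (0, 1)| ≤ 4 * |ε| * CB := by gcongr
      linarith
    have hsq := sq_le_sq' (neg_le_of_abs_le hb) (le_of_abs_le hb)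
    rw [mul_pow, sq_abs] at hsq
    have : g w / √(1 + g w ^ 2) * (ε * firstVariation V φ w
        - 4 * ε ^ 2 * (φ w * fderiv ℝ φ w (0, 1))) =
        (ε * (g w / √(1 + g w ^ 2) * firstVariation V φ w)
      - 4 * ε ^ 2 * (g w / √(1 + g w ^ 2) * (φ w * fderiv ℝ φ w (0, 1)))) := by ring
    rw [this]
    linarith
  have jA : Integrable (fun w => ε * (g w / √(1 + g w ^ 2) * firstVariation V φ w))
      (volume.restrict K) := iA.const_mul ε
  have jB : Integrable (fun w => 4 * ε ^ 2 *
      (g w / √(1 + g w ^ 2) * (φ w * fderiv ℝ φ w (0, 1)))) (volume.restrict K) :=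
    iB.const_mul (4 * ε ^ 2)
  have jAB := jA.sub jB
  have jS : Integrable (fun w => √(1 + g w ^ 2) +
      (ε * (g w / √(1 + g w ^ 2) * firstVariation V φ w)
      - 4 * ε ^ 2 * (g w / √(1 + g w ^ 2) * (φ w * fderiv ℝ φ w (0, 1)))))
      (volume.restrict K) := i0.add jAB
  rw [integral_add jS (integrable_const _), integral_add i0 (by exact jAB),
    integral_sub jA jB, integral_const_mul, integral_const_mul, integral_const] at hle
  have := hmin.trans hle
  simp only [measureReal_restrict_apply_univ, smul_eq_mul] at this
  linarith

end BurgersMinimizer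

section
variable {V : ℝ × ℝ → ℝ} {L : NNReal} {M : ℝ}

lemma lipschitzWith_sq_of_bounded (hV : LipschitzWith L V) (hM : ∀ w, |V w| ≤ M) :
    LipschitzWith (2 * Real.toNNReal M * L) fun w => V w ^ 2 := by
  refine LipschitzWith.of_dist_le_mul fun x y => ?_
  have hM0 : 0 ≤ M := (abs_nonneg _).trans (hM 0)
  have h := hV.dist_le_mul x y
  rw [Real.dist_eq] at h ⊢
  have e : V x ^ 2 - V y ^ 2 = (V x + V y) * (V x - V y) := by ring
  rw [e, abs_mul]
  push_cast
  rw [Real.coe_toNNReal _ hM0, mul_assoc]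
  refine mul_le_mul ?_ h (abs_nonneg _) (by positivity)
  exact (abs_add_le _ _).trans (by linarith [hM x, hM y])

lemma ae_lineDeriv_sq (hV : LipschitzWith L V) (e : ℝ × ℝ) :
    ∀ᵐ w, lineDeriv ℝ (fun w => V w ^ 2) w e = 2 * V w * lineDeriv ℝ V w e := by
  filter_upwards [hV.ae_differentiableAt (μ := volume)] with w hw
  rw [(hw.fun_pow 2).lineDeriv_eq_fderiv, hw.lineDeriv_eq_fderiv, fderiv_fun_pow _ hw]
  simp

/-- A Lipschitz function satisfies the Burgers integration by parts with its pointwise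
derivatives. -/
lemma integral_burgers_mul (hV : LipschitzWith L V) (hM : ∀ w, |V w| ≤ M) {ψ : ℝ × ℝ → ℝ}
    (hψ : ContDiff ℝ 1 ψ) (hc : HasCompactSupport ψ) :
    ∫ w, (lineDeriv ℝ V w (1, 0) - 4 * V w * lineDeriv ℝ V w (0, 1)) * ψ w =
      -∫ w, (V w * fderiv ℝ ψ w (1, 0) - 2 * V w ^ 2 * fderiv ℝ ψ w (0, 1)) := by
  have I1 := integral_lineDeriv_mul_eq_neg hV hψ hc (1, 0)
  have I2 := integral_lineDeriv_mul_eq_neg (lipschitzWith_sq_of_bounded hV hM) hψ hc (0, 1)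
  have cV := hV.continuous
  have c1 := continuous_fderiv_apply_of_contDiff hψ (1, 0)
  have c2 := continuous_fderiv_apply_of_contDiff hψ (0, 1)
  have J1 : Integrable fun w => lineDeriv ℝ V w (1, 0) * ψ w :=
    measurable_bounded_mul_integrable (measurable_lineDeriv cV) (abs_lineDeriv_horizontal_le hV)
      hψ.continuous hc
  have J2 : Integrable fun w => lineDeriv ℝ (fun w => V w ^ 2) w (0, 1) * ψ w :=
    measurable_bounded_mul_integrable (measurable_lineDeriv (cV.pow 2))
      (abs_lineDeriv_vertical_le (lipschitzWith_sq_of_bounded hV hM)) hψ.continuous hc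
  have J3 : Integrable fun w => V w * fderiv ℝ ψ w (1, 0) :=
    (cV.mul c1).integrable_of_hasCompactSupport (hc.fderiv_apply ℝ _).mul_left
  have J4 : Integrable fun w => V w ^ 2 * fderiv ℝ ψ w (0, 1) :=
    ((cV.pow 2).mul c2).integrable_of_hasCompactSupport (hc.fderiv_apply ℝ _).mul_left
  have e1 : ∫ w, (lineDeriv ℝ V w (1, 0) - 4 * V w * lineDeriv ℝ V w (0, 1)) * ψ w =
      ∫ w, (lineDeriv ℝ V w (1, 0) * ψ w
        - 2 * (lineDeriv ℝ (fun w => V w ^ 2) w (0, 1) * ψ w)) := by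
    apply integral_congr_ae
    filter_upwards [ae_lineDeriv_sq hV (0, 1)] with w hw
    rw [hw]; ring
  have e2 : ∫ w, (V w * fderiv ℝ ψ w (1, 0) - 2 * V w ^ 2 * fderiv ℝ ψ w (0, 1)) =
      ∫ w, (V w * fderiv ℝ ψ w (1, 0) - 2 * (V w ^ 2 * fderiv ℝ ψ w (0, 1))) := by
    simp only [mul_assoc]
  rw [e1, e2, integral_sub J1 (J2.const_mul 2), integral_sub J3 (J4.const_mul 2),
    integral_const_mul, integral_const_mul, I1, I2]
  ring

/-- The distributional Burgers derivative of a Lipschitz function is its pointwise one. -/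
lemma BurgersMinimizer.ae_eq_burgers {Ω U : Set (ℝ × ℝ)} {v g : ℝ × ℝ → ℝ}
    (H : BurgersMinimizer Ω v g) (hU : IsOpen U) (hUΩ : U ⊆ Ω) (hV : LipschitzWith L V)
    (hVv : ∀ w ∈ U, V w = v w) (hM : ∀ w, |V w| ≤ M) :
    ∀ᵐ w, w ∈ U → g w = lineDeriv ℝ V w (1, 0) - 4 * V w * lineDeriv ℝ V w (0, 1) := by
  have hM0 : 0 ≤ M := (abs_nonneg _).trans (hM 0)
  set f := fun w => lineDeriv ℝ V w (1, 0) - 4 * V w * lineDeriv ℝ V w (0, 1) with hf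
  have cV := hV.continuous
  have mf : Measurable f := (measurable_lineDeriv cV).sub
    ((cV.measurable.const_mul 4).mul (measurable_lineDeriv cV))
  have bf : ∀ w, |f w| ≤ L + 4 * M * L := by
    intro w
    refine (abs_sub _ _).trans (add_le_add (abs_lineDeriv_horizontal_le hV w) ?_)
    rw [abs_mul, abs_mul, abs_of_pos (by norm_num : (0:ℝ) < 4)]
    have := abs_lineDeriv_vertical_le hV w
    have := hM w
    gcongr
  have hli : LocallyIntegrableOn (fun w => g w - f w) U := by
    rw [locallyIntegrableOn_iff (hU.isLocallyClosed)]
    intro K hKU hK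
    have gm : AEStronglyMeasurable g (volume.restrict K) :=
      H.aestronglyMeasurable.mono_measure (Measure.restrict_mono (hKU.trans hUΩ) le_rfl)
    obtain ⟨B, hB⟩ := H.bounded _ hK (hKU.trans hUΩ)
    have : IsFiniteMeasure (volume.restrict K) := ⟨by simpa using hK.measure_lt_top⟩
    exact (Integrable.of_bound gm B hB).sub
      (Integrable.of_bound mf.aestronglyMeasurable _ (Eventually.of_forall bf))
  have := hU.ae_eq_zero_of_integral_contDiff_smul_eq_zero hli ?_
  · filter_upwards [this] with w hw hwU
    exact sub_eq_zero.1 (hw hwU)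
  intro ψ hψ hc hs
  have hsΩ := hs.trans hUΩ
  have hψ1 : ContDiff ℝ 1 ψ := hψ.of_le (by exact_mod_cast le_top)
  have i1 := H.integrable_mul_test hψ.continuous hc hsΩ
  have i2 := measurable_bounded_mul_integrable mf bf hψ.continuous hc
  have e0 : ∫ w, ψ w • (g w - f w) = ∫ w in Ω, ψ w • (g w - f w) := by
    symm
    apply setIntegral_eq_integral_of_forall_compl_eq_zero
    intro w hw
    simp [image_eq_zero_of_notMem_tsupport fun h => hw (hsΩ h)]
  have e1 : ∫ w in Ω, ψ w • (g w - f w) = (∫ w in Ω, g w * ψ w) - ∫ w in Ω, f w * ψ w := by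
    rw [← integral_sub i1 i2.integrableOn]
    congr 1; ext w
    simp only [smul_eq_mul]; ring
  have e2 : ∫ w in Ω, f w * ψ w = ∫ w, f w * ψ w := by
    apply setIntegral_eq_integral_of_forall_compl_eq_zero
    intro w hw
    simp [image_eq_zero_of_notMem_tsupport fun h => hw (hsΩ h)]
  have e3 : ∫ w in Ω, (v w * fderiv ℝ ψ w (1, 0) - 2 * (v w) ^ 2 * fderiv ℝ ψ w (0, 1)) =
      ∫ w, (V w * fderiv ℝ ψ w (1, 0) - 2 * (V w) ^ 2 * fderiv ℝ ψ w (0, 1)) := by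
    have : ∀ w, v w * fderiv ℝ ψ w (1, 0) - 2 * (v w) ^ 2 * fderiv ℝ ψ w (0, 1) =
        V w * fderiv ℝ ψ w (1, 0) - 2 * (V w) ^ 2 * fderiv ℝ ψ w (0, 1) := by
      intro w
      by_cases hw : w ∈ tsupport ψ
      · rw [hVv w (hs hw)]
      · simp [fderiv_eq_zero_of_notMem_tsupport hw]
    simp only [this]
    apply setIntegral_eq_integral_of_forall_compl_eq_zero
    intro w hw
    simp [fderiv_eq_zero_of_notMem_tsupport fun h => hw (hsΩ h)]
  rw [e0, e1, e2, H.integral_eq ψ hψ hc hsΩ, e3, integral_burgers_mul hV hM hψ1 hc]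
  ring
end

/-- `Γ · s` solves `γ' = -4 V(y, γ)` on `(a, b)` with `γ(y₁) = s`. -/
structure IsCharFlow (V : ℝ × ℝ → ℝ) (a b y₁ : ℝ) (Γ : ℝ → ℝ → ℝ) : Prop where
  mem : y₁ ∈ Ioo a b
  base : ∀ s, Γ y₁ s = s
  hasDerivAt : ∀ s, ∀ y ∈ Ioo a b, HasDerivAt (fun y => Γ y s) (-4 * V (y, Γ y s)) y

section
variable {V : ℝ × ℝ → ℝ} {L : NNReal} {M a b y₁ : ℝ}

lemma exists_isCharFlow (hV : LipschitzWith L V) (hM : ∀ w, |V w| ≤ M) (hy : y₁ ∈ Ioo a b) :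
    ∃ Γ, IsCharFlow V a b y₁ Γ := by
  have hM0 : 0 ≤ M := (abs_nonneg _).trans (hM 0)
  have hmem : y₁ ∈ Icc a b := Ioo_subset_Icc_self hy
  have key : ∀ s : ℝ, ∃ α : ℝ → ℝ, α y₁ = s ∧
      ∀ t ∈ Icc a b, HasDerivWithinAt α (-4 * V (t, α t)) (Icc a b) t := by
    intro s
    have hP : IsPicardLindelof (fun y t => -4 * V (y, t)) (⟨y₁, hmem⟩ : Icc a b) s
        (Real.toNNReal (4 * M * max (b - y₁) (y₁ - a))) 0 (Real.toNNReal (4 * M)) (4 * L) := by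
      refine ⟨fun t _ => ?_, fun x _ => ?_, fun t _ x _ => ?_, ?_⟩
      · refine LipschitzOnWith.of_dist_le_mul fun x _ y _ => ?_
        have := hV.dist_le_mul (t, x) (t, y)
        rw [Prod.dist_eq, dist_self, max_eq_right dist_nonneg] at this
        rw [Real.dist_eq] at this ⊢
        have e : -4 * V (t, x) - -4 * V (t, y) = -4 * (V (t, x) - V (t, y)) := by ring
        rw [e, abs_mul]
        push_cast
        norm_num
        linarith
      · have := hV.continuous
        fun_prop
      · rw [Real.norm_eq_abs, abs_mul, Real.coe_toNNReal _ (by positivity)]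
        have := hM (t, x)
        norm_num
        linarith
      · have : 0 ≤ max (b - y₁) (y₁ - a) := le_max_of_le_left (by linarith [hy.2])
        rw [Real.coe_toNNReal _ (by positivity), Real.coe_toNNReal _ (by positivity)]
        simp
    exact hP.exists_eq_forall_mem_Icc_hasDerivWithinAt₀
  choose Γ h1 h2 using key
  refine ⟨fun y s => Γ s y, hy, h1, fun s y hy => ?_⟩
  exact (h2 s y (Ioo_subset_Icc_self hy)).hasDerivAt (Icc_mem_nhds hy.1 hy.2)

/-- A Gronwall comparison on an open interval, in both directions. -/
lemma abs_le_exp_mul_of_abs_deriv_le {δ δ' : ℝ → ℝ} {C : ℝ}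
    (hd : ∀ y ∈ Ioo a b, HasDerivAt δ (δ' y) y) (hC : ∀ y ∈ Ioo a b, |δ' y| ≤ C * |δ y|)
    {y z : ℝ} (hy : y ∈ Ioo a b) (hz : z ∈ Ioo a b) :
    |δ y| ≤ Real.exp (C * |y - z|) * |δ z| := by
  have hcross : ∀ y ∈ Ioo a b, |δ y * δ' y| ≤ C * δ y ^ 2 := by
    intro y hy
    rw [abs_mul, ← sq_abs (δ y)]
    nlinarith [hC y hy, abs_nonneg (δ y)]
  have hE : ∀ (c : ℝ), ∀ y ∈ Ioo a b, HasDerivAt (fun y => δ y ^ 2 * Real.exp (c * y))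
      (2 * (δ y * δ' y) * Real.exp (c * y) + δ y ^ 2 * (Real.exp (c * y) * c)) y := by
    intro c y hy
    have h1 := (hd y hy).fun_pow 2
    have h2 : HasDerivAt (fun y => Real.exp (c * y)) (Real.exp (c * y) * c) y := by
      simpa using ((hasDerivAt_id y).const_mul c).exp
    refine (h1.mul h2).congr_deriv ?_
    push_cast
    ring
  have mono : MonotoneOn (fun y => δ y ^ 2 * Real.exp (2 * C * y)) (Ioo a b) := by
    refine monotoneOn_of_deriv_nonneg (convex_Ioo a b)
      (fun y hy => (hE _ y hy).continuousAt.continuousWithinAt)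
      (fun y hy => ?_) fun y hy => ?_
    · rw [interior_Ioo] at hy
      exact (hE _ y hy).differentiableAt.differentiableWithinAt
    · rw [interior_Ioo] at hy
      rw [(hE _ y hy).deriv]
      have := (abs_le.1 (hcross y hy)).1
      have e := Real.exp_pos (2 * C * y)
      nlinarith
  have anti : AntitoneOn (fun y => δ y ^ 2 * Real.exp (-(2 * C) * y)) (Ioo a b) := by
    refine antitoneOn_of_deriv_nonpos (convex_Ioo a b)
      (fun y hy => (hE _ y hy).continuousAt.continuousWithinAt)
      (fun y hy => ?_) fun y hy => ?_
    · rw [interior_Ioo] at hy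
      exact (hE _ y hy).differentiableAt.differentiableWithinAt
    · rw [interior_Ioo] at hy
      rw [(hE _ y hy).deriv]
      have := (abs_le.1 (hcross y hy)).2
      have e := Real.exp_pos (-(2 * C) * y)
      nlinarith
  have hsq : δ y ^ 2 ≤ (Real.exp (C * |y - z|) * |δ z|) ^ 2 := by
    rw [mul_pow, sq_abs, ← Real.exp_nat_mul]
    rcases le_total y z with h | h
    · have := mono hy hz h
      simp only at this
      rw [abs_of_nonpos (by linarith)]
      have e : Real.exp (2 * C * z) =
          Real.exp (((2:ℕ):ℝ) * (C * -(y - z))) * Real.exp (2 * C * y) := by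
        rw [← Real.exp_add]; congr 1; push_cast; ring
      rw [e] at this
      have p := Real.exp_pos (2 * C * y)
      nlinarith
    · have := anti hz hy h
      simp only at this
      rw [abs_of_nonneg (by linarith)]
      have e : Real.exp (-(2 * C) * z) =
          Real.exp (((2:ℕ):ℝ) * (C * (y - z))) * Real.exp (-(2 * C) * y) := by
        rw [← Real.exp_add]; congr 1; push_cast; ring
      rw [e] at this
      have p := Real.exp_pos (-(2 * C) * y)
      nlinarith
  exact abs_le_of_sq_le_sq hsq (by positivity)

namespace IsCharFlow
variable {Γ : ℝ → ℝ → ℝ}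

lemma hasDerivAt_sub (h : IsCharFlow V a b y₁ Γ) (s s' : ℝ) {y : ℝ} (hy : y ∈ Ioo a b) :
    HasDerivAt (fun y => Γ y s' - Γ y s) (-4 * V (y, Γ y s') - -4 * V (y, Γ y s)) y :=
  (h.hasDerivAt s' y hy).sub (h.hasDerivAt s y hy)

lemma abs_deriv_sub_le (hV : LipschitzWith L V) (s s' y : ℝ) :
    |-4 * V (y, Γ y s') - -4 * V (y, Γ y s)| ≤ 4 * L * |Γ y s' - Γ y s| := by
  have := hV.dist_le_mul (y, Γ y s') (y, Γ y s)
  rw [Prod.dist_eq, dist_self, max_eq_right dist_nonneg, Real.dist_eq, Real.dist_eq] at this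
  have e : -4 * V (y, Γ y s') - -4 * V (y, Γ y s) = -4 * (V (y, Γ y s') - V (y, Γ y s)) := by ring
  rw [e, abs_mul]
  norm_num
  linarith

lemma abs_sub_le (h : IsCharFlow V a b y₁ Γ) (hV : LipschitzWith L V) (s s' : ℝ) {y : ℝ}
    (hy : y ∈ Ioo a b) : |Γ y s' - Γ y s| ≤ Real.exp (4 * L * (b - a)) * |s' - s| := by
  have := abs_le_exp_mul_of_abs_deriv_le (fun y hy => h.hasDerivAt_sub s s' hy)
    (fun y _ => abs_deriv_sub_le hV s s' y) hy h.mem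
  rw [h.base, h.base] at this
  refine this.trans ?_
  have : |y - y₁| ≤ b - a := by
    rw [abs_le]; constructor <;> linarith [hy.1, hy.2, h.mem.1, h.mem.2]
  gcongr

lemma le_abs_sub (h : IsCharFlow V a b y₁ Γ) (hV : LipschitzWith L V) (s s' : ℝ) {y : ℝ}
    (hy : y ∈ Ioo a b) : |s' - s| ≤ Real.exp (4 * L * (b - a)) * |Γ y s' - Γ y s| := by
  have := abs_le_exp_mul_of_abs_deriv_le (fun y hy => h.hasDerivAt_sub s s' hy)
    (fun y _ => abs_deriv_sub_le hV s s' y) h.mem hy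
  rw [h.base, h.base] at this
  refine this.trans ?_
  have : |y₁ - y| ≤ b - a := by
    rw [abs_le]; constructor <;> linarith [hy.1, hy.2, h.mem.1, h.mem.2]
  gcongr

lemma continuousOn (h : IsCharFlow V a b y₁ Γ) (s : ℝ) :
    ContinuousOn (fun y => Γ y s) (Ioo a b) :=
  fun y hy => (h.hasDerivAt s y hy).continuousAt.continuousWithinAt

lemma lt (h : IsCharFlow V a b y₁ Γ) (hV : LipschitzWith L V) {s s' : ℝ} (hs : s < s') {y : ℝ}
    (hy : y ∈ Ioo a b) : Γ y s < Γ y s' := by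
  by_contra! hle
  have hc : ContinuousOn (fun y => Γ y s' - Γ y s) (Ioo a b) :=
    (h.continuousOn s').sub (h.continuousOn s)
  have := isPreconnected_Ioo.intermediate_value hy h.mem hc
  obtain ⟨z, hz, h0⟩ := this (show (0:ℝ) ∈ _ from
    ⟨by linarith, by rw [h.base, h.base]; linarith⟩)
  have h1 := h.le_abs_sub hV s s' hz
  simp only at h0
  rw [h0, abs_zero, mul_zero] at h1
  have := abs_pos.2 (sub_pos.2 hs).ne'
  linarith

lemma abs_sub_base_le (h : IsCharFlow V a b y₁ Γ) (hM : ∀ w, |V w| ≤ M) (s : ℝ) {y z : ℝ}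
    (hy : y ∈ Ioo a b) (hz : z ∈ Ioo a b) : |Γ y s - Γ z s| ≤ 4 * M * |y - z| := by
  refine (convex_Ioo a b).norm_image_sub_le_of_norm_hasDerivWithin_le
    (f := fun y => Γ y s) (f' := fun y => -4 * V (y, Γ y s))
    (fun x hx => (h.hasDerivAt s x hx).hasDerivWithinAt) (fun x _ => ?_) hz hy
  rw [Real.norm_eq_abs, abs_mul]
  have := hM (x, Γ x s)
  norm_num
  linarith

lemma continuousOn_uncurry (h : IsCharFlow V a b y₁ Γ) (hV : LipschitzWith L V) :
    ContinuousOn (fun w : ℝ × ℝ => Γ w.1 w.2) (Ioo a b ×ˢ univ) := by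
  refine continuousOn_prod_of_continuousOn_lipschitzOnWith' _
    (Real.toNNReal (Real.exp (4 * L * (b - a)))) (fun y hy => ?_) fun s _ => h.continuousOn s
  refine LipschitzOnWith.of_dist_le_mul fun s _ s' _ => ?_
  rw [Real.coe_toNNReal _ (Real.exp_pos _).le]
  exact h.abs_sub_le hV _ _ hy

end IsCharFlow
end

lemma AntilipschitzWith.ae_comp_of_ae {f : ℝ → ℝ} {K : NNReal} (hf : AntilipschitzWith K f)
    {p : ℝ → Prop} (hp : ∀ᵐ t, p t) : ∀ᵐ s, p (f s) := by
  rw [ae_iff] at hp ⊢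
  have := hf.hausdorffMeasure_preimage_le (zero_le_one) {t | ¬ p t}
  rw [hausdorffMeasure_real, hp, mul_zero] at this
  exact le_antisymm this zero_le

/-- A property valid almost everywhere holds almost everywhere along almost every characteristic. -/
lemma IsCharFlow.ae_ae {V : ℝ × ℝ → ℝ} {L : NNReal} {a b y₁ : ℝ} {Γ : ℝ → ℝ → ℝ}
    (h : IsCharFlow V a b y₁ Γ) (hV : LipschitzWith L V) {p : ℝ × ℝ → Prop} (hp : ∀ᵐ w, p w) :
    ∀ᵐ s, ∀ᵐ y, y ∈ Ioo a b → p (y, Γ y s) := by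
  set Z := toMeasurable volume {w | ¬ p w} with hZ
  have Zm : MeasurableSet Z := measurableSet_toMeasurable _ _
  have Z0 : volume Z = 0 := by rw [hZ, measure_toMeasurable]; exact hp
  have hpZ : ∀ w, w ∉ Z → p w := fun w hw => by
    by_contra hn
    exact hw (subset_toMeasurable _ _ hn)
  suffices hs : ∀ᵐ s, ∀ᵐ y, y ∈ Ioo a b → (y, Γ y s) ∉ Z by
    filter_upwards [hs] with s hs
    filter_upwards [hs] with y hy hyI using hpZ _ (hy hyI)
  have hI : MeasurableSet (Ioo a b ×ˢ (univ : Set ℝ)) := measurableSet_Ioo.prod MeasurableSet.univ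
  have hm : MeasurableSet {w : ℝ × ℝ | w.1 ∈ Ioo a b → (w.1, Γ w.1 w.2) ∉ Z} := by
    classical
    have hG : Measurable ((Ioo a b ×ˢ (univ : Set ℝ)).piecewise
        (fun w : ℝ × ℝ => Γ w.1 w.2) fun _ => 0) :=
      (h.continuousOn_uncurry hV).measurable_piecewise continuousOn_const hI
    have hmS := hI.inter ((measurable_fst.prodMk hG) Zm)
    convert hmS.compl using 1
    ext w
    by_cases hw : w.1 ∈ Ioo a b
    · have hw' : w ∈ Ioo a b ×ˢ (univ : Set ℝ) := ⟨hw, mem_univ _⟩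
      simp only [mem_compl_iff, mem_inter_iff, mem_preimage, piecewise_eq_of_mem _ _ _ hw', hw',
        true_and]
      exact ⟨fun h => h hw, fun h _ => h⟩
    · exact iff_of_true (fun h => absurd h hw) fun h => hw h.1.1
  refine (Measure.ae_ae_comm (p := fun y s => y ∈ Ioo a b → (y, Γ y s) ∉ Z) hm).1 ?_
  have : ∀ᵐ w ∂(volume : Measure ℝ).prod (volume : Measure ℝ), w ∉ Z := by
    rw [← Measure.volume_eq_prod]
    exact measure_eq_zero_iff_ae_notMem.1 Z0
  filter_upwards [Measure.ae_ae_of_ae_prod this] with y hy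
  by_cases hyI : y ∈ Ioo a b
  · have hA : AntilipschitzWith (Real.toNNReal (Real.exp (4 * L * (b - a)))) (Γ y) := by
      refine AntilipschitzWith.of_le_mul_dist fun s s' => ?_
      rw [Real.coe_toNNReal _ (Real.exp_pos _).le]
      exact h.le_abs_sub hV _ _ hyI
    filter_upwards [hA.ae_comp_of_ae hy] with s hs _ using hs
  · filter_upwards with s hs using absurd hs hyI

lemma deriv_smoothTransition_of_nonpos {x : ℝ} (hx : x ≤ 0) :
    deriv Real.smoothTransition x = 0 := by
  have hmin : IsLocalMin Real.smoothTransition x := by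
    filter_upwards with y
    rw [Real.smoothTransition.zero_of_nonpos hx]
    exact Real.smoothTransition.nonneg y
  exact hmin.deriv_eq_zero

lemma deriv_smoothTransition_of_one_le {x : ℝ} (hx : 1 ≤ x) :
    deriv Real.smoothTransition x = 0 := by
  have hmax : IsLocalMax Real.smoothTransition x := by
    filter_upwards with y
    rw [Real.smoothTransition.one_of_one_le hx]
    exact Real.smoothTransition.le_one y
  exact hmax.deriv_eq_zero

lemma exists_bound_mul_deriv_smoothTransition :
    ∃ K, 0 ≤ K ∧ ∀ x, |x * deriv Real.smoothTransition x| ≤ K := by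
  have hc : Continuous (deriv Real.smoothTransition) :=
    (Real.smoothTransition.contDiff (n := 1)).continuous_deriv le_rfl
  obtain ⟨K, hK⟩ := (isCompact_Icc (a := (0:ℝ)) (b := 1)).exists_bound_of_continuousOn
    (f := fun x => x * deriv Real.smoothTransition x) (by fun_prop)
  have h0 := hK 0 (by simp)
  simp only [zero_mul, norm_zero] at h0
  refine ⟨K, h0, fun x => ?_⟩
  rcases le_total x 0 with h | h
  · simpa [deriv_smoothTransition_of_nonpos h] using h0
  rcases le_total 1 x with h' | h'
  · simpa [deriv_smoothTransition_of_one_le h'] using h0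
  exact hK x ⟨h, h'⟩

/-- A smooth cutoff across the curve `t = γ(y)`, at scale `1 / |c|`. -/
def curveCutoff (c : ℝ) (γ : ℝ → ℝ) (w : ℝ × ℝ) : ℝ :=
  Real.smoothTransition (c * (w.2 - γ w.1))

section
variable {V : ℝ × ℝ → ℝ} {L : NNReal} {a b a₁ b₁ c : ℝ} {γ γ' χ : ℝ → ℝ}

lemma curveCutoff_nonneg (w : ℝ × ℝ) : 0 ≤ curveCutoff c γ w := Real.smoothTransition.nonneg _

lemma curveCutoff_le_one (w : ℝ × ℝ) : curveCutoff c γ w ≤ 1 := Real.smoothTransition.le_one _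

lemma hasFDerivAt_curveCutoff {w : ℝ × ℝ} {d : ℝ} (hγ : HasDerivAt γ d w.1) :
    HasFDerivAt (curveCutoff c γ)
      ((deriv Real.smoothTransition (c * (w.2 - γ w.1)) * c) •
        (ContinuousLinearMap.snd ℝ ℝ ℝ - d • ContinuousLinearMap.fst ℝ ℝ ℝ)) w := by
  have h1 : HasFDerivAt (fun w : ℝ × ℝ => γ w.1) (d • ContinuousLinearMap.fst ℝ ℝ ℝ) w :=
    hγ.comp_hasFDerivAt w hasFDerivAt_fst
  have h2 := (hasFDerivAt_snd.sub h1).const_mul c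
  have h3 : HasDerivAt Real.smoothTransition
      (deriv Real.smoothTransition (c * (w.2 - γ w.1))) (c * (w.2 - γ w.1)) :=
    ((Real.smoothTransition.contDiff (n := 1)).differentiable one_ne_zero _).hasDerivAt
  have h4 := h3.comp_hasFDerivAt w h2
  rw [smul_smul] at h4
  exact h4

lemma contDiffAt_curveCutoff {w : ℝ × ℝ} (hγ : ContDiffAt ℝ 1 γ w.1) :
    ContDiffAt ℝ 1 (curveCutoff c γ) w := by
  have h1 : ContDiffAt ℝ 1 (fun w : ℝ × ℝ => γ w.1) w := hγ.comp w contDiffAt_fst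
  exact Real.smoothTransition.contDiff.contDiffAt.comp w
    (contDiffAt_const.mul (contDiffAt_snd.sub h1))

/-- The derivative of a cutoff along the characteristic field is bounded uniformly in the scale. -/
lemma abs_cutoff_transport_le (hV : LipschitzWith L V) {K : ℝ}
    (hK : ∀ x, |x * deriv Real.smoothTransition x| ≤ K) (w : ℝ × ℝ) (p : ℝ) :
    |deriv Real.smoothTransition (c * (w.2 - p)) * c * (4 * (V (w.1, p) - V w))| ≤ 4 * L * K := by
  have h1 := hV.dist_le_mul (w.1, p) (w.1, w.2)
  rw [Prod.dist_eq, dist_self, max_eq_right dist_nonneg, Real.dist_eq, Real.dist_eq,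
    abs_sub_comm p] at h1
  have h2 := hK (c * (w.2 - p))
  rw [abs_mul, abs_mul c] at h2
  rw [abs_mul, abs_mul, abs_mul]
  have e : |(4:ℝ)| = 4 := by norm_num
  rw [e]
  have h3 : 0 ≤ |deriv Real.smoothTransition (c * (w.2 - p))| * |c| := by positivity
  have h4 : |V (w.1, p) - V w| ≤ L * |w.2 - p| := h1
  calc _ ≤ |deriv Real.smoothTransition (c * (w.2 - p))| * |c| * (4 * (L * |w.2 - p|)) := by gcongr
    _ = 4 * L * (|c| * |w.2 - p| * |deriv Real.smoothTransition (c * (w.2 - p))|) := by ring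
    _ ≤ _ := by gcongr

/-- A test function concentrated between the curves `γ` and `γ'`. -/
def tubeTest (χ γ γ' : ℝ → ℝ) (n : ℝ) (w : ℝ × ℝ) : ℝ :=
  χ w.1 * (curveCutoff n γ w * curveCutoff (-n) γ' w)

lemma tubeTest_eq_zero {n : ℝ} (hn : 0 ≤ n) {w : ℝ × ℝ} (hw : w.2 ≤ γ w.1 ∨ γ' w.1 ≤ w.2) :
    tubeTest χ γ γ' n w = 0 := by
  rcases hw with h | h
  · have : curveCutoff n γ w = 0 := Real.smoothTransition.zero_of_nonpos
      (mul_nonpos_of_nonneg_of_nonpos hn (by linarith))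
    simp [tubeTest, this]
  · have : curveCutoff (-n) γ' w = 0 := Real.smoothTransition.zero_of_nonpos
      (mul_nonpos_of_nonpos_of_nonneg (by linarith) (by linarith))
    simp [tubeTest, this]

lemma contDiff_tubeTest (hχ : ContDiff ℝ 1 χ) (hs : tsupport χ ⊆ Ioo a b)
    (hγ : ContDiffOn ℝ 1 γ (Ioo a b)) (hγ' : ContDiffOn ℝ 1 γ' (Ioo a b)) (n : ℝ) :
    ContDiff ℝ 1 (tubeTest χ γ γ' n) := by
  rw [contDiff_iff_contDiffAt]
  intro w
  by_cases hw : w.1 ∈ tsupport χ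
  · have hm := Ioo_mem_nhds (hs hw).1 (hs hw).2
    exact (hχ.contDiffAt.comp w contDiffAt_fst).mul
      ((contDiffAt_curveCutoff (hγ.contDiffAt hm)).mul (contDiffAt_curveCutoff (hγ'.contDiffAt hm)))
  · have : tubeTest χ γ γ' n =ᶠ[𝓝 w] fun _ => 0 := by
      have h1 : ∀ᶠ y in 𝓝 w.1, χ y = 0 := notMem_tsupport_iff_eventuallyEq.1 hw
      filter_upwards [(continuous_fst.tendsto w).eventually h1] with z hz
      simp [tubeTest, hz]
    exact contDiffAt_const.congr_of_eventuallyEq this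

lemma isClosed_tube (hab : Icc a₁ b₁ ⊆ Ioo a b) (hγ : ContinuousOn γ (Ioo a b))
    (hγ' : ContinuousOn γ' (Ioo a b)) :
    IsClosed {w : ℝ × ℝ | w.1 ∈ Icc a₁ b₁ ∧ w.2 ∈ Icc (γ w.1) (γ' w.1)} := by
  have hc : IsClosed (Icc a₁ b₁ ×ˢ (univ : Set ℝ)) := isClosed_Icc.prod isClosed_univ
  have m : MapsTo (Prod.fst : ℝ × ℝ → ℝ) (Icc a₁ b₁ ×ˢ (univ : Set ℝ)) (Ioo a b) :=
    fun w hw => hab hw.1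
  have c1 : ContinuousOn (fun w : ℝ × ℝ => (w.2 - γ w.1, γ' w.1 - w.2))
      (Icc a₁ b₁ ×ˢ (univ : Set ℝ)) :=
    (continuousOn_snd.sub (hγ.comp continuousOn_fst m)).prodMk
      ((hγ'.comp continuousOn_fst m).sub continuousOn_snd)
  have := c1.preimage_isClosed_of_isClosed hc (isClosed_Ici (a := ((0:ℝ), (0:ℝ))))
  convert this using 1
  ext w
  simp [Prod.le_def, mem_prod]

lemma exists_tube_box (hab : Icc a₁ b₁ ⊆ Ioo a b) (hγ : ContinuousOn γ (Ioo a b))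
    (hγ' : ContinuousOn γ' (Ioo a b)) :
    ∃ lo hi, {w : ℝ × ℝ | w.1 ∈ Icc a₁ b₁ ∧ w.2 ∈ Icc (γ w.1) (γ' w.1)} ⊆
      Icc a₁ b₁ ×ˢ Icc lo hi := by
  obtain ⟨lo, hlo⟩ := (isCompact_Icc.image_of_continuousOn (hγ.mono hab)).bddBelow
  obtain ⟨hi, hhi⟩ := (isCompact_Icc.image_of_continuousOn (hγ'.mono hab)).bddAbove
  exact ⟨lo, hi, fun w hw => ⟨hw.1, (hlo (mem_image_of_mem _ hw.1)).trans hw.2.1,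
    hw.2.2.trans (hhi (mem_image_of_mem _ hw.1))⟩⟩

lemma tsupport_tubeTest_subset (hab : Icc a₁ b₁ ⊆ Ioo a b) (hγ : ContinuousOn γ (Ioo a b))
    (hγ' : ContinuousOn γ' (Ioo a b)) (hs : tsupport χ ⊆ Icc a₁ b₁) {n : ℝ} (hn : 0 ≤ n) :
    tsupport (tubeTest χ γ γ' n) ⊆
      {w : ℝ × ℝ | w.1 ∈ Icc a₁ b₁ ∧ w.2 ∈ Icc (γ w.1) (γ' w.1)} := by
  refine closure_minimal (fun w hw => ⟨hs (subset_tsupport _ fun h => hw ?_), ?_⟩)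
    (isClosed_tube hab hγ hγ')
  · simp [tubeTest, h]
  · by_contra h
    apply hw
    apply tubeTest_eq_zero hn
    by_contra! h'
    exact h ⟨h'.1.le, h'.2.le⟩

lemma firstVariation_tubeTest (hχ : ContDiff ℝ 1 χ) {n : ℝ} {w : ℝ × ℝ}
    (hγ : HasDerivAt γ (-4 * V (w.1, γ w.1)) w.1) (hγ' : HasDerivAt γ' (-4 * V (w.1, γ' w.1)) w.1) :
    firstVariation V (tubeTest χ γ γ' n) w =
      (deriv χ w.1 - 4 * lineDeriv ℝ V w (0, 1) * χ w.1) *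
        (curveCutoff n γ w * curveCutoff (-n) γ' w) +
      χ w.1 *
        (deriv Real.smoothTransition (n * (w.2 - γ w.1)) * n * (4 * (V (w.1, γ w.1) - V w)) *
          curveCutoff (-n) γ' w +
        curveCutoff n γ w * (deriv Real.smoothTransition (-n * (w.2 - γ' w.1)) * -n *
          (4 * (V (w.1, γ' w.1) - V w)))) := by
  have h1 := hasFDerivAt_curveCutoff (c := n) hγ
  have h2 := hasFDerivAt_curveCutoff (c := -n) hγ'
  have h3 : HasFDerivAt (fun w : ℝ × ℝ => χ w.1)
      (deriv χ w.1 • ContinuousLinearMap.fst ℝ ℝ ℝ) w :=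
    ((hχ.differentiable one_ne_zero _).hasDerivAt).comp_hasFDerivAt w hasFDerivAt_fst
  have h4 := h3.fun_mul (h1.fun_mul h2)
  have h5 : fderiv ℝ (tubeTest χ γ γ' n) w = _ := h4.fderiv
  rw [firstVariation, h5]
  simp only [add_apply, smul_apply, sub_apply,
    ContinuousLinearMap.coe_fst', ContinuousLinearMap.coe_snd',
    smul_eq_mul, tubeTest]
  ring
end

section
variable {V q : ℝ × ℝ → ℝ} {L : NNReal} {a b a₁ b₁ : ℝ} {γ γ' χ : ℝ → ℝ}

lemma tendsto_curveCutoff {n : ℕ → ℝ} (hn : Tendsto n atTop atTop) {x : ℝ} :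
    Tendsto (fun k => Real.smoothTransition (n k * x)) atTop (𝓝 (if 0 < x then 1 else 0)) := by
  split_ifs with h
  · apply tendsto_const_nhds.congr'
    filter_upwards [hn.eventually_ge_atTop x⁻¹] with k hk
    refine (Real.smoothTransition.one_of_one_le ?_).symm
    calc (1:ℝ) = x⁻¹ * x := by field_simp
      _ ≤ n k * x := by gcongr
  · apply tendsto_const_nhds.congr'
    filter_upwards [hn.eventually_ge_atTop 0] with k hk
    exact (Real.smoothTransition.zero_of_nonpos
      (mul_nonpos_of_nonneg_of_nonpos hk (not_lt.1 h))).symm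

lemma eventually_deriv_smoothTransition_mul_eq_zero {n : ℕ → ℝ} (hn : Tendsto n atTop atTop)
    {x : ℝ} : ∀ᶠ k in atTop, deriv Real.smoothTransition (n k * x) = 0 := by
  rcases lt_or_ge 0 x with h | h
  · filter_upwards [hn.eventually_ge_atTop x⁻¹] with k hk
    refine deriv_smoothTransition_of_one_le ?_
    calc (1:ℝ) = x⁻¹ * x := by field_simp
      _ ≤ n k * x := by gcongr
  · filter_upwards [hn.eventually_ge_atTop 0] with k hk
    exact deriv_smoothTransition_of_nonpos (mul_nonpos_of_nonneg_of_nonpos hk h)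

/-- Characteristics of a continuous function are continuously differentiable. -/
lemma contDiffOn_of_hasDerivAt_char (hV : Continuous V) {γ : ℝ → ℝ}
    (hγ : ∀ y ∈ Ioo a b, HasDerivAt γ (-4 * V (y, γ y)) y) : ContDiffOn ℝ 1 γ (Ioo a b) := by
  have cg : ContinuousOn γ (Ioo a b) := fun y hy => (hγ y hy).continuousAt.continuousWithinAt
  rw [show (1 : WithTop ℕ∞) = 0 + 1 from rfl, contDiffOn_succ_iff_deriv_of_isOpen isOpen_Ioo]
  refine ⟨fun y hy => (hγ y hy).differentiableAt.differentiableWithinAt, by simp, ?_⟩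
  rw [contDiffOn_zero]
  have : ContinuousOn (fun y => -4 * V (y, γ y)) (Ioo a b) := by fun_prop
  exact this.congr fun y hy => (hγ y hy).deriv

/-- Passing to sharp cutoffs in the weak equation: the flux balance over the tube between two
characteristics. -/
lemma integrable_and_integral_tube_eq_zero {U : Set (ℝ × ℝ)} (hV : LipschitzWith L V)
    (hq : Measurable q) (hq1 : ∀ w, |q w| ≤ 1)
    (hEL : ∀ φ : ℝ × ℝ → ℝ, ContDiff ℝ 1 φ → HasCompactSupport φ → tsupport φ ⊆ U →
      ∫ w, q w * firstVariation V φ w = 0)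
    (hab : Icc a₁ b₁ ⊆ Ioo a b)
    (hγ : ∀ y ∈ Ioo a b, HasDerivAt γ (-4 * V (y, γ y)) y)
    (hγ' : ∀ y ∈ Ioo a b, HasDerivAt γ' (-4 * V (y, γ' y)) y)
    (hU : ∀ y ∈ Icc a₁ b₁, ∀ t ∈ Icc (γ y) (γ' y), (y, t) ∈ U)
    (hlt : ∀ y ∈ Icc a₁ b₁, γ y < γ' y)
    (hχ : ContDiff ℝ 1 χ) (hs : tsupport χ ⊆ Icc a₁ b₁) :
    Integrable (fun y => deriv χ y * (∫ t in γ y..γ' y, q (y, t)) -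
      4 * χ y * ∫ t in γ y..γ' y, q (y, t) * lineDeriv ℝ V (y, t) (0, 1)) ∧
    ∫ y, (deriv χ y * (∫ t in γ y..γ' y, q (y, t)) -
      4 * χ y * ∫ t in γ y..γ' y, q (y, t) * lineDeriv ℝ V (y, t) (0, 1)) = 0 := by
  have cγ : ContinuousOn γ (Ioo a b) := fun y hy => (hγ y hy).continuousAt.continuousWithinAt
  have cγ' : ContinuousOn γ' (Ioo a b) := fun y hy => (hγ' y hy).continuousAt.continuousWithinAt
  have cV := hV.continuous
  obtain ⟨lo, hi, hbox⟩ := exists_tube_box hab cγ cγ'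
  obtain ⟨K, hK0, hK⟩ := exists_bound_mul_deriv_smoothTransition
  have hχc : HasCompactSupport χ := HasCompactSupport.intro' isCompact_Icc isClosed_Icc
    fun x hx => image_eq_zero_of_notMem_tsupport fun h => hx (hs h)
  obtain ⟨C0, hC0⟩ := hχ.continuous.bounded_above_of_compact_support hχc
  obtain ⟨C1, hC1⟩ := (hχ.continuous_deriv le_rfl).bounded_above_of_compact_support hχc.deriv
  have hC0' : 0 ≤ C0 := (norm_nonneg _).trans (hC0 0)
  have hC1' : 0 ≤ C1 := (norm_nonneg _).trans (hC1 0)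
  set T : Set (ℝ × ℝ) := {w | w.1 ∈ Icc a₁ b₁ ∧ w.2 ∈ Icc (γ w.1) (γ' w.1)} with hT
  set n : ℕ → ℝ := fun k => (k : ℝ) with hn
  have hn0 : ∀ k, 0 ≤ n k := fun k => Nat.cast_nonneg k
  have hnt : Tendsto n atTop atTop := tendsto_natCast_atTop_atTop
  set B : Set (ℝ × ℝ) := Icc a₁ b₁ ×ˢ Icc lo hi with hB
  have Bc : IsCompact B := isCompact_Icc.prod isCompact_Icc
  have htsub : ∀ k, tsupport (tubeTest χ γ γ' (n k)) ⊆ T := fun k =>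
    tsupport_tubeTest_subset hab cγ cγ' hs (hn0 k)
  have hcd : ∀ k, ContDiff ℝ 1 (tubeTest χ γ γ' (n k)) := fun k =>
    contDiff_tubeTest hχ (hs.trans hab) (contDiffOn_of_hasDerivAt_char cV hγ)
      (contDiffOn_of_hasDerivAt_char cV hγ') _
  set F : ℕ → ℝ × ℝ → ℝ := fun k w => q w * firstVariation V (tubeTest χ γ γ' (n k)) w with hF
  have hF0 : ∀ k, ∫ w, F k w = 0 := fun k => hEL _ (hcd k)
    (Bc.of_isClosed_subset (isClosed_tsupport _) ((htsub k).trans hbox))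
    ((htsub k).trans fun w hw => hU _ hw.1 _ hw.2)
  have hFm : ∀ k, Measurable (F k) := fun k => hq.mul (measurable_firstVariation hV (hcd k))
  set C := C1 + 4 * L * C0 + C0 * (4 * L * K + 4 * L * K) with hC
  have hCpos : 0 ≤ C := by positivity
  set bound : ℝ × ℝ → ℝ := B.indicator fun _ => C with hbound
  have hbi : Integrable bound :=
    (integrable_indicator_iff Bc.measurableSet).2 (integrableOn_const Bc.measure_lt_top.ne)
  have hFb : ∀ k w, ‖F k w‖ ≤ bound w := by
    intro k w
    by_cases hw : w ∈ T
    · have hwI := hab hw.1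
      rw [hbound, indicator_of_mem (hbox hw), Real.norm_eq_abs, hF]
      simp only
      rw [abs_mul, firstVariation_tubeTest hχ (hγ _ hwI) (hγ' _ hwI)]
      refine (mul_le_of_le_one_left (abs_nonneg _) (hq1 w)).trans ?_
      have A0 : |curveCutoff (n k) γ w| ≤ 1 := by
        rw [abs_of_nonneg (curveCutoff_nonneg w)]; exact curveCutoff_le_one w
      have A1 : |curveCutoff (-n k) γ' w| ≤ 1 := by
        rw [abs_of_nonneg (curveCutoff_nonneg w)]; exact curveCutoff_le_one w
      have A2 := abs_cutoff_transport_le (c := n k) hV hK w (γ w.1)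
      have A3 := abs_cutoff_transport_le (c := -n k) hV hK w (γ' w.1)
      have A4 := hC0 w.1
      have A5 := hC1 w.1
      rw [Real.norm_eq_abs] at A4 A5
      have A6 : |deriv χ w.1 - 4 * lineDeriv ℝ V w (0, 1) * χ w.1| ≤ C1 + 4 * L * C0 := by
        refine (abs_sub _ _).trans (add_le_add A5 ?_)
        rw [abs_mul, abs_mul, abs_of_pos (by norm_num : (0:ℝ) < 4)]
        have := abs_lineDeriv_vertical_le hV w
        gcongr
      have mul1 : ∀ {x y X : ℝ}, |x| ≤ X → |y| ≤ 1 → |x * y| ≤ X := by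
        intro x y X hx hy
        rw [abs_mul]
        exact (mul_le_of_le_one_right (abs_nonneg _) hy).trans hx
      refine (abs_add_le _ _).trans (add_le_add (mul1 A6 (mul1 A0 A1)) ?_)
      rw [abs_mul]
      refine mul_le_mul A4 ((abs_add_le _ _).trans (add_le_add (mul1 A2 A1) ?_)) (abs_nonneg _) hC0'
      rw [mul_comm]
      exact mul1 A3 A0
    · rw [hF]
      simp only
      rw [firstVariation_eq_zero fun h => hw (htsub k h), mul_zero, norm_zero, hbound]
      exact indicator_nonneg (fun _ _ => hCpos) _
  set S : Set (ℝ × ℝ) := {w | w.1 ∈ Icc a₁ b₁ ∧ w.2 ∈ Ioo (γ w.1) (γ' w.1)} with hS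
  set G : ℝ × ℝ → ℝ := S.indicator fun w =>
    q w * (deriv χ w.1 - 4 * lineDeriv ℝ V w (0, 1) * χ w.1) with hG
  have hlim : ∀ w, Tendsto (fun k => F k w) atTop (𝓝 (G w)) := by
    intro w
    by_cases hw1 : w.1 ∈ Icc a₁ b₁
    · have hwI := hab hw1
      have hev : ∀ᶠ k in atTop, F k w =
          q w * ((deriv χ w.1 - 4 * lineDeriv ℝ V w (0, 1) * χ w.1) *
          (Real.smoothTransition (n k * (w.2 - γ w.1)) *
            Real.smoothTransition (n k * (γ' w.1 - w.2)))) := by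
        filter_upwards [eventually_deriv_smoothTransition_mul_eq_zero hnt (x := w.2 - γ w.1),
          eventually_deriv_smoothTransition_mul_eq_zero hnt (x := γ' w.1 - w.2)] with k h1 h2
        have e : -n k * (w.2 - γ' w.1) = n k * (γ' w.1 - w.2) := by ring
        rw [hF]
        simp only
        rw [firstVariation_tubeTest hχ (hγ _ hwI) (hγ' _ hwI), e, h1, h2, curveCutoff, curveCutoff,
          e]
        ring
      have hl := (((tendsto_curveCutoff hnt (x := w.2 - γ w.1)).mul
        (tendsto_curveCutoff hnt (x := γ' w.1 - w.2))).const_mul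
        (deriv χ w.1 - 4 * lineDeriv ℝ V w (0, 1) * χ w.1)).const_mul (q w)
      refine (hl.congr' (hev.mono fun k hk => hk.symm)).trans (le_of_eq ?_)
      congr 1
      by_cases h1 : γ w.1 < w.2 <;> by_cases h2 : w.2 < γ' w.1 <;>
        simp [hG, hS, hw1.1, hw1.2, h1, h2]
    · have : ∀ k, F k w = 0 := fun k => by
        rw [hF]
        simp only
        rw [firstVariation_eq_zero fun h => hw1 (htsub k h).1, mul_zero]
      simp only [this]
      rw [hG, indicator_of_notMem fun h => hw1 h.1]
      exact tendsto_const_nhds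
  have hGint : Integrable G := by
    refine hbi.mono' (aestronglyMeasurable_of_tendsto_ae atTop
      (fun k => (hFm k).aestronglyMeasurable) (Eventually.of_forall hlim)) ?_
    filter_upwards with w
    exact le_of_tendsto (hlim w).norm (Eventually.of_forall fun k => hFb k w)
  have hG0 : ∫ w, G w = 0 := by
    have := tendsto_integral_of_dominated_convergence bound
      (fun k => (hFm k).aestronglyMeasurable (μ := volume)) hbi
      (fun k => Eventually.of_forall (hFb k)) (Eventually.of_forall hlim)
    simp only [hF0] at this
    exact (tendsto_nhds_unique this tendsto_const_nhds)
  rw [Measure.volume_eq_prod] at hGint hG0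
  rw [integral_prod _ hGint] at hG0
  suffices key : (fun y => deriv χ y * (∫ t in γ y..γ' y, q (y, t)) -
      4 * χ y * ∫ t in γ y..γ' y, q (y, t) * lineDeriv ℝ V (y, t) (0, 1)) =
      fun y => ∫ t, G (y, t) by
    rw [key]
    exact ⟨hGint.integral_prod_left, hG0⟩
  ext y
  by_cases hy : y ∈ Icc a₁ b₁
  · have hγle := (hlt y hy).le
    have bdd : ∀ f : ℝ → ℝ, Measurable f → (∃ c, ∀ t, |f t| ≤ c) →
        IntegrableOn f (Ioo (γ y) (γ' y)) := by
      rintro f hf ⟨c, hc⟩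
      exact Measure.integrableOn_of_bounded (M := c) (by simp)
        hf.aestronglyMeasurable (Eventually.of_forall hc)
    have mq : Measurable fun t => q (y, t) := hq.comp measurable_prodMk_left
    have mV : Measurable fun t => lineDeriv ℝ V (y, t) (0, 1) :=
      (measurable_lineDeriv cV).comp measurable_prodMk_left
    have i1 := bdd _ mq ⟨1, fun t => hq1 _⟩
    have i2 := bdd _ (mq.mul mV) ⟨L, fun t => by
      simp only [Pi.mul_apply]
      rw [abs_mul]
      exact (mul_le_of_le_one_left (abs_nonneg _) (hq1 _)).trans (abs_lineDeriv_vertical_le hV _)⟩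
    have e1 : ∀ t, G (y, t) = (Ioo (γ y) (γ' y)).indicator (fun t => deriv χ y * q (y, t) -
        4 * χ y * (q (y, t) * lineDeriv ℝ V (y, t) (0, 1))) t := by
      intro t
      by_cases ht : t ∈ Ioo (γ y) (γ' y)
      · rw [indicator_of_mem ht, hG, indicator_of_mem (show (y, t) ∈ S from ⟨hy, ht⟩)]
        ring
      · rw [indicator_of_notMem ht, hG, indicator_of_notMem fun h => ht h.2]
    simp only [e1]
    rw [integral_indicator measurableSet_Ioo, intervalIntegral.integral_of_le hγle,
      intervalIntegral.integral_of_le hγle, integral_Ioc_eq_integral_Ioo,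
      integral_Ioc_eq_integral_Ioo,
      integral_sub (i1.const_mul (deriv χ y)) (by exact i2.const_mul (4 * χ y)),
      integral_const_mul, integral_const_mul]
  · have h1 : χ y = 0 := image_eq_zero_of_notMem_tsupport fun h => hy (hs h)
    have h2 : deriv χ y = 0 := by
      by_contra h
      exact hy (hs (support_deriv_subset h))
    have e1 : ∀ t, G (y, t) = 0 := fun t => by
      rw [hG, indicator_of_notMem fun h => hy h.1]
    simp [h1, h2, e1]
end

section
variable {V q : ℝ × ℝ → ℝ} {L : NNReal} {M a b c d a₁ b₁ y₁ s₀ s₁ : ℝ} {Γ : ℝ → ℝ → ℝ}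

/-- Quotients of vertical increments converge along sequences. -/
lemma tendsto_div_of_hasDerivAt_vertical {f : ℝ → ℝ} {f' t : ℝ} (hf : HasDerivAt f f' t)
    {τ : ℕ → ℝ} (hτ : Tendsto τ atTop (𝓝 t)) (hne : ∀ᶠ k in atTop, τ k ≠ t) :
    Tendsto (fun k => (f (τ k) - f t) / (τ k - t)) atTop (𝓝 f') := by
  have h1 := hf.tendsto_slope
  have h2 : Tendsto τ atTop (𝓝[≠] t) := tendsto_nhdsWithin_iff.2 ⟨hτ, hne⟩
  refine (h1.comp h2).congr fun k => ?_
  simp [slope_def_field]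

/-- Along almost every characteristic the flux is weakly constant. -/
lemma ae_integral_deriv_mul_char_eq_zero (hV : LipschitzWith L V)
    (hq : Measurable q) (hq1 : ∀ w, |q w| ≤ 1)
    (hEL : ∀ φ : ℝ × ℝ → ℝ, ContDiff ℝ 1 φ → HasCompactSupport φ →
      tsupport φ ⊆ Ioo a b ×ˢ Ioo c d → ∫ w, q w * firstVariation V φ w = 0)
    (hΓ : IsCharFlow V a b y₁ Γ) (hab : Icc a₁ b₁ ⊆ Ioo a b)
    (hU : ∀ y ∈ Icc a₁ b₁, ∀ s ∈ Ioo s₀ s₁, Γ y s ∈ Ioo c d) :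
    ∀ᵐ s, s ∈ Ioo s₀ s₁ → ∀ ω : ℝ → ℝ, ContDiff ℝ 1 ω → tsupport ω ⊆ Icc a₁ b₁ →
      ∫ y, deriv ω y * q (y, Γ y s) = 0 := by
  have cV := hV.continuous
  have mV : Measurable fun w => lineDeriv ℝ V w (0, 1) := measurable_lineDeriv cV
  have P1 := ae_hasDerivAt_vertical_primitive hq hq1
  have P2 := ae_hasDerivAt_vertical_primitive (f := fun w => q w * lineDeriv ℝ V w (0, 1))
    (C := L) (hq.mul mV) fun w => by
      rw [abs_mul]
      exact (mul_le_of_le_one_left (abs_nonneg _) (hq1 _)).trans (abs_lineDeriv_vertical_le hV _)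
  have P3 : ∀ᵐ w : ℝ × ℝ, HasDerivAt (fun t => V (w.1, t)) (lineDeriv ℝ V w (0, 1)) w.2 := by
    filter_upwards [hV.ae_differentiableAt (μ := volume)] with w hw
    rw [hw.lineDeriv_eq_fderiv]
    have h1 : HasDerivAt (fun t : ℝ => ((w.1, t) : ℝ × ℝ)) (0, 1) w.2 :=
      (hasDerivAt_const _ _).prodMk (hasDerivAt_id _)
    exact HasFDerivAt.comp_hasDerivAt w.2 hw.hasFDerivAt h1
  filter_upwards [hΓ.ae_ae hV ((P1.and P2).and P3)] with s hs hsJ ω hω hsω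
  have iq : ∀ y u u', IntervalIntegrable (fun t => q (y, t)) volume u u' := fun y u u' =>
    (intervalIntegrable_const (c := (1:ℝ))).mono_fun
      (hq.comp measurable_prodMk_left).aestronglyMeasurable
      (Eventually.of_forall fun t => by simpa using hq1 (y, t))
  have bqV : ∀ w, |q w * lineDeriv ℝ V w (0, 1)| ≤ L := fun w => by
    rw [abs_mul]
    exact (mul_le_of_le_one_left (abs_nonneg _) (hq1 _)).trans (abs_lineDeriv_vertical_le hV _)
  have iqV : ∀ y u u', IntervalIntegrable (fun t => q (y, t) * lineDeriv ℝ V (y, t) (0, 1))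
      volume u u' := fun y u u' =>
    (intervalIntegrable_const (c := (L:ℝ))).mono_fun
      ((hq.mul mV).comp measurable_prodMk_left).aestronglyMeasurable
      (Eventually.of_forall fun t => by simpa using bqV (y, t))
  have hωc : HasCompactSupport ω := HasCompactSupport.intro' isCompact_Icc isClosed_Icc
    fun x hx => image_eq_zero_of_notMem_tsupport fun h => hx (hsω h)
  set σ : ℕ → ℝ := fun k => s + 1 / ((k : ℝ) + 1) with hσ
  have hσs : ∀ k, s < σ k := fun k => by
    have : (0:ℝ) < 1 / ((k : ℝ) + 1) := by positivity
    simp only [hσ]; linarith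
  have hσt : Tendsto σ atTop (𝓝 s) := by
    have := (tendsto_one_div_add_atTop_nhds_zero_nat (𝕜 := ℝ)).const_add s
    rw [add_zero] at this
    exact this
  set δ : ℕ → ℝ → ℝ := fun k y => Γ y (σ k) - Γ y s with hδ
  have hδ0 : ∀ k, ∀ y ∈ Ioo a b, 0 < δ k y := fun k y hy => sub_pos.2 (hΓ.lt hV (hσs k) hy)
  have hδd : ∀ k, ∀ y ∈ Ioo a b,
      HasDerivAt (δ k) (-4 * V (y, Γ y (σ k)) - -4 * V (y, Γ y s)) y :=
    fun k y hy => hΓ.hasDerivAt_sub s (σ k) hy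
  set χ : ℕ → ℝ → ℝ := fun k y => ω y / δ k y with hχ
  have hχs : ∀ k, tsupport (χ k) ⊆ tsupport ω := fun k =>
    closure_mono fun y hy h => hy (by simp only [hχ]; rw [h, zero_div])
  have hχc : ∀ k, ContDiff ℝ 1 (χ k) := by
    intro k
    rw [contDiff_iff_contDiffAt]
    intro y
    by_cases hy : y ∈ tsupport ω
    · have hyI := hab (hsω hy)
      have hm := Ioo_mem_nhds hyI.1 hyI.2
      have hδc : ContDiffAt ℝ 1 (δ k) y :=
        ((contDiffOn_of_hasDerivAt_char cV (hΓ.hasDerivAt (σ k))).contDiffAt hm).sub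
          ((contDiffOn_of_hasDerivAt_char cV (hΓ.hasDerivAt s)).contDiffAt hm)
      exact hω.contDiffAt.fun_div hδc (hδ0 k y hyI).ne'
    · have : χ k =ᶠ[𝓝 y] fun _ => 0 := by
        filter_upwards [notMem_tsupport_iff_eventuallyEq.1 hy] with z hz
        simp only [hχ]
        rw [hz]; simp
      exact contDiffAt_const.congr_of_eventuallyEq this
  set F : ℕ → ℝ → ℝ := fun k y => deriv (χ k) y * (∫ t in Γ y s..Γ y (σ k), q (y, t)) -
      4 * χ k y * ∫ t in Γ y s..Γ y (σ k), q (y, t) * lineDeriv ℝ V (y, t) (0, 1) with hF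
  have hF0 : ∀ᶠ k in atTop, Integrable (F k) ∧ ∫ y, F k y = 0 := by
    filter_upwards [hσt.eventually (gt_mem_nhds hsJ.2)] with k hk
    have hkJ : σ k ∈ Ioo s₀ s₁ := ⟨hsJ.1.trans (hσs k), hk⟩
    refine integrable_and_integral_tube_eq_zero hV hq hq1 hEL hab (hΓ.hasDerivAt s)
      (hΓ.hasDerivAt (σ k)) (fun y hy t ht => ?_) (fun y hy => hΓ.lt hV (hσs k) (hab hy)) (hχc k)
      ((hχs k).trans hsω)
    exact ⟨hab hy, (hU y hy s hsJ).1.trans_le ht.1, ht.2.trans_lt (hU y hy _ hkJ).2⟩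
  have hFeq : ∀ k, ∀ y ∈ Icc a₁ b₁, F k y =
      deriv ω y * ((∫ t in Γ y s..Γ y (σ k), q (y, t)) / δ k y) -
      ω y * (-4 * ((V (y, Γ y (σ k)) - V (y, Γ y s)) / δ k y)) *
        ((∫ t in Γ y s..Γ y (σ k), q (y, t)) / δ k y) -
      4 * ω y * ((∫ t in Γ y s..Γ y (σ k), q (y, t) * lineDeriv ℝ V (y, t) (0, 1)) / δ k y) := by
    intro k y hy
    have hyI := hab hy
    have h0 := (hδ0 k y hyI).ne'
    have h1 := ((hω.differentiable one_ne_zero y).hasDerivAt.fun_div (hδd k y hyI) h0).deriv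
    simp only [hF]
    rw [h1]
    simp only [hχ]
    field_simp
    ring
  have hF00 : ∀ k, ∀ y ∉ Icc a₁ b₁, F k y = 0 := by
    intro k y hy
    have h1 : χ k y = 0 := image_eq_zero_of_notMem_tsupport fun h => hy (hsω (hχs k h))
    have h2 : deriv (χ k) y = 0 := by
      by_contra h
      exact hy (hsω (hχs k (support_deriv_subset h)))
    simp [hF, h1, h2]
  have hlim : ∀ᵐ y, Tendsto (fun k => F k y) atTop (𝓝 (deriv ω y * q (y, Γ y s))) := by
    filter_upwards [hs] with y hy
    by_cases hyJ : y ∈ Icc a₁ b₁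
    · have hyI := hab hyJ
      obtain ⟨⟨d1, d2⟩, d3⟩ := hy hyI
      have hτ : Tendsto (fun k => Γ y (σ k)) atTop (𝓝 (Γ y s)) := by
        have h1 := ((hσt.sub_const s).abs).const_mul (Real.exp (4 * L * (b - a)))
        rw [sub_self, abs_zero, mul_zero] at h1
        rw [tendsto_iff_dist_tendsto_zero]
        exact squeeze_zero (fun _ => dist_nonneg)
          (fun k => by rw [Real.dist_eq]; exact hΓ.abs_sub_le hV s (σ k) hyI) h1
      have hne : ∀ᶠ k in atTop, Γ y (σ k) ≠ Γ y s :=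
        Eventually.of_forall fun k => (hΓ.lt hV (hσs k) hyI).ne'
      have t1 := tendsto_div_of_hasDerivAt_vertical d1 hτ hne
      have t2 := tendsto_div_of_hasDerivAt_vertical d2 hτ hne
      have t3 := tendsto_div_of_hasDerivAt_vertical d3 hτ hne
      simp only [intervalIntegral.integral_interval_sub_left (iq y _ _) (iq y _ _)] at t1
      simp only [intervalIntegral.integral_interval_sub_left (iqV y _ _) (iqV y _ _)] at t2
      have t4 := ((t1.const_mul (deriv ω y)).sub (((t3.const_mul (-4)).const_mul (ω y)).mul t1)).sub
        (t2.const_mul (4 * ω y))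
      refine (t4.congr fun k => (hFeq k y hyJ).symm).trans (le_of_eq ?_)
      congr 1
      ring
    · have : deriv ω y = 0 := by
        by_contra h
        exact hyJ (hsω (support_deriv_subset h))
      simp only [hF00 _ y hyJ, this, zero_mul]
      exact tendsto_const_nhds
  have hbound : ∀ k, ∀ y, ‖F k y‖ ≤ |deriv ω y| + 8 * L * |ω y| := by
    intro k y
    by_cases hyJ : y ∈ Icc a₁ b₁
    · have hyI := hab hyJ
      have h0 := hδ0 k y hyI
      have dq : ∀ {x C : ℝ}, |x| ≤ C * |δ k y| → |x / δ k y| ≤ C := by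
        intro x C hx
        rw [abs_div]
        exact (div_le_iff₀ (abs_pos.2 h0.ne')).2 hx
      have b1 : |(∫ t in Γ y s..Γ y (σ k), q (y, t)) / δ k y| ≤ 1 := by
        have h : ‖∫ t in Γ y s..Γ y (σ k), q (y, t)‖ ≤ 1 * |Γ y (σ k) - Γ y s| :=
          intervalIntegral.norm_integral_le_of_norm_le_const fun t _ => hq1 _
        exact dq h
      have b2 :
          |(∫ t in Γ y s..Γ y (σ k), q (y, t) * lineDeriv ℝ V (y, t) (0, 1)) / δ k y| ≤ L := by
        have h : ‖∫ t in Γ y s..Γ y (σ k), q (y, t) * lineDeriv ℝ V (y, t) (0, 1)‖ ≤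
            L * |Γ y (σ k) - Γ y s| :=
          intervalIntegral.norm_integral_le_of_norm_le_const fun t _ => bqV _
        exact dq h
      have b3 : |(V (y, Γ y (σ k)) - V (y, Γ y s)) / δ k y| ≤ L := dq <| by
        have := hV.dist_le_mul (y, Γ y (σ k)) (y, Γ y s)
        rwa [Prod.dist_eq, dist_self, max_eq_right dist_nonneg, Real.dist_eq, Real.dist_eq] at this
      rw [hFeq k y hyJ, Real.norm_eq_abs]
      generalize (∫ t in Γ y s..Γ y (σ k), q (y, t)) / δ k y = A at *
      generalize (∫ t in Γ y s..Γ y (σ k), q (y, t) * lineDeriv ℝ V (y, t) (0, 1)) / δ k y = A2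
        at *
      generalize (V (y, Γ y (σ k)) - V (y, Γ y s)) / δ k y = A3 at *
      have e1 : |deriv ω y * A| ≤ |deriv ω y| := by
        rw [abs_mul]; exact mul_le_of_le_one_right (abs_nonneg _) b1
      have e2 : |ω y * (-4 * A3) * A| ≤ 4 * L * |ω y| := by
        rw [abs_mul, abs_mul, abs_mul]
        norm_num
        have : |ω y| * (4 * |A3|) * |A| ≤ |ω y| * (4 * L) * 1 := by gcongr
        linarith
      have e3 : |4 * ω y * A2| ≤ 4 * L * |ω y| := by
        rw [abs_mul, abs_mul]
        norm_num
        have : 4 * |ω y| * |A2| ≤ 4 * |ω y| * L := by gcongr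
        linarith
      refine (abs_sub _ _).trans ((add_le_add ((abs_sub _ _).trans (add_le_add e1 e2)) e3).trans ?_)
      linarith
    · rw [hF00 k y hyJ, norm_zero]; positivity
  have hbi : Integrable fun y => |deriv ω y| + 8 * L * |ω y| := by
    have c1 := hω.continuous_deriv le_rfl
    have c2 := hω.continuous
    exact ((c1.integrable_of_hasCompactSupport hωc.deriv).abs).add
      ((c2.integrable_of_hasCompactSupport hωc).abs.const_mul _)
  have := tendsto_integral_filter_of_dominated_convergence _
    (hF0.mono fun k hk => hk.1.aestronglyMeasurable)
    (Eventually.of_forall fun k => Eventually.of_forall (hbound k)) hbi hlim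
  exact tendsto_nhds_unique this (tendsto_const_nhds.congr' (hF0.mono fun k hk => hk.2.symm))
end

/-- Du Bois-Reymond: a bounded function which is weakly constant on an interval is constant
almost everywhere. -/
lemma exists_ae_eq_const_of_integral_deriv_mul_eq_zero {f : ℝ → ℝ} {a b : ℝ} (hab : a < b)
    (hf : Measurable f) (hf1 : ∀ y, |f y| ≤ 1)
    (h : ∀ ω : ℝ → ℝ, ContDiff ℝ 1 ω → tsupport ω ⊆ Icc a b → ∫ y, deriv ω y * f y = 0) :
    ∃ k, ∀ᵐ y, y ∈ Ioo a b → f y = k := by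
  have lf : LocallyIntegrable f := (locallyIntegrable_const (1 : ℝ)).mono hf.aestronglyMeasurable
    (Eventually.of_forall fun y => by simpa using hf1 y)
  let B : ContDiffBump ((a + b) / 2) := ⟨(b - a) / 8, (b - a) / 4, by linarith, by linarith⟩
  set ρ : ℝ → ℝ := B.normed volume with hρ
  have ρc : Continuous ρ := B.continuous_normed
  have ρs : HasCompactSupport ρ := B.hasCompactSupport_normed
  have ρ1 : ∫ y, ρ y = 1 := B.integral_normed
  have ρ0 : ∀ y ∉ Ioo a b, ρ y = 0 := by
    intro y hy
    by_contra hne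
    have : y ∈ Function.support ρ := hne
    rw [hρ, B.support_normed_eq, Real.ball_eq_Ioo] at this
    have hB : B.rOut = (b - a) / 4 := rfl
    rw [hB] at this
    apply hy
    constructor <;> linarith [this.1, this.2]
  have ifρ : Integrable fun y => ρ y * f y := by
    simpa using (lf.integrable_smul_left_of_hasCompactSupport ρc ρs)
  refine ⟨∫ y, ρ y * f y, ?_⟩
  set k := ∫ y, ρ y * f y with hk
  have main := isOpen_Ioo.ae_eq_zero_of_integral_contDiff_smul_eq_zero (μ := volume)
    (U := Ioo a b) (f := fun y => f y - k)
    ((lf.sub (locallyIntegrable_const k)).locallyIntegrableOn _) ?_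
  · filter_upwards [main] with y hy hyI using sub_eq_zero.1 (hy hyI)
  intro ψ hψ hψc hψs
  have cψ := hψ.continuous
  have iψ : Integrable ψ := cψ.integrable_of_hasCompactSupport hψc
  have iρ : Integrable ρ := ρc.integrable_of_hasCompactSupport ρs
  have ifψ : Integrable fun y => ψ y * f y := by
    simpa using (lf.integrable_smul_left_of_hasCompactSupport cψ hψc)
  set m := ∫ y, ψ y with hm
  set θ : ℝ → ℝ := fun y => ψ y - m * ρ y with hθ
  have cθ : Continuous θ := by fun_prop
  have θ0 : ∀ y ∉ Ioo a b, θ y = 0 := by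
    intro y hy
    simp only [hθ]
    rw [ρ0 y hy, image_eq_zero_of_notMem_tsupport fun h => hy (hψs h)]; ring
  have iθ : ∫ y, θ y = 0 := by
    simp only [hθ]
    rw [integral_sub iψ (iρ.const_mul m), integral_const_mul, ρ1]; ring
  set ω : ℝ → ℝ := fun y => ∫ x in a..y, θ x with hω
  have dω : ∀ y, HasDerivAt ω (θ y) y := fun y =>
    intervalIntegral.integral_hasDerivAt_right (cθ.intervalIntegrable _ _)
      (cθ.stronglyMeasurableAtFilter _ _) cθ.continuousAt
  have eω : deriv ω = θ := funext fun y => (dω y).deriv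
  have ω1 : ContDiff ℝ 1 ω := by
    rw [contDiff_one_iff_deriv]
    exact ⟨fun y => (dω y).differentiableAt, by rw [eω]; exact cθ⟩
  have ωs : tsupport ω ⊆ Icc a b := by
    refine closure_minimal (fun y hy => ?_) isClosed_Icc
    by_contra hn
    apply hy
    rw [mem_Icc, not_and_or, not_le, not_le] at hn
    rcases hn with hn | hn
    · simp only [hω]
      rw [intervalIntegral.integral_congr (g := fun _ => 0), intervalIntegral.integral_zero]
      intro x hx
      rw [uIcc_of_ge hn.le] at hx
      exact θ0 x fun h => absurd hx.2 (not_le.2 h.1)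
    · simp only [hω]
      rw [intervalIntegral.integral_of_le (by linarith), ← iθ]
      refine setIntegral_eq_integral_of_forall_compl_eq_zero fun x hx => θ0 x fun h => hx ?_
      exact ⟨h.1, by linarith [h.2]⟩
  have e := h ω ω1 ωs
  rw [eω] at e
  have e1 : ∫ y, θ y * f y = (∫ y, ψ y * f y) - m * k := by
    rw [hk, ← integral_const_mul, ← integral_sub ifψ (ifρ.const_mul m)]
    congr 1; ext y; simp only [hθ]; ring
  have e2 : ∫ y, ψ y • (f y - k) = (∫ y, ψ y * f y) - m * k := by
    rw [hm, ← integral_mul_const, ← integral_sub ifψ (iψ.mul_const k)]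
    congr 1; ext y; simp only [smul_eq_mul]; ring
  rw [e2, ← e1, e]

/-- A Lipschitz function with almost everywhere constant derivative is affine. -/
lemma LipschitzOnWith.eq_affine_of_ae_hasDerivAt {u : ℝ → ℝ} {K : NNReal} {a b κ : ℝ}
    (hab : a ≤ b) (hu : LipschitzOnWith K u (Icc a b))
    (hd : ∀ᵐ y, y ∈ Ioo a b → HasDerivAt u κ y) {y : ℝ} (hy : y ∈ Icc a b) :
    u y = u a + κ * (y - a) := by
  have h1 : AbsolutelyContinuousOnInterval u a b := by
    apply LipschitzOnWith.absolutelyContinuousOnInterval (K := K)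
    rwa [uIcc_of_le hab]
  have h2 : AbsolutelyContinuousOnInterval (fun y => κ * y) a b := by
    apply LipschitzOnWith.absolutelyContinuousOnInterval (K := ‖κ‖₊)
    refine LipschitzOnWith.of_dist_le_mul fun x _ y _ => ?_
    rw [Real.dist_eq, Real.dist_eq, ← mul_sub, abs_mul]; rfl
  have h3 := (h1.sub h2).const_of_ae_hasDerivAt_zero ?_
  · obtain ⟨C, hC⟩ := h3
    have e1 := hC y (by rwa [uIcc_of_le hab])
    have e2 := hC a (by simp)
    simp only [Pi.sub_apply] at e1 e2
    linarith
  · have n1 : ∀ᵐ y : ℝ, y ≠ a := Measure.ae_ne volume a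
    have n2 : ∀ᵐ y : ℝ, y ≠ b := Measure.ae_ne volume b
    filter_upwards [hd, n1, n2] with y hy hya hyb hyI
    rw [uIcc_of_le hab] at hyI
    have := (hy ⟨lt_of_le_of_ne hyI.1 hya.symm, lt_of_le_of_ne hyI.2 hyb⟩).sub
      ((hasDerivAt_id y).const_mul κ)
    exact this.congr_deriv (by ring)

/-- A bounded Lipschitz function extends to a Lipschitz function with the same bound. -/
lemma LipschitzOnWith.exists_bounded_extension {v : ℝ × ℝ → ℝ} {L : NNReal} {M : ℝ}
    {U : Set (ℝ × ℝ)} (hv : LipschitzOnWith L v U) (hM0 : 0 ≤ M) (hM : ∀ w ∈ U, |v w| ≤ M) :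
    ∃ V : ℝ × ℝ → ℝ, LipschitzWith L V ∧ (∀ w, |V w| ≤ M) ∧ ∀ w ∈ U, V w = v w := by
  obtain ⟨V₀, hV₀, hV₀v⟩ := hv.extend_real
  refine ⟨fun w => max (-M) (min M (V₀ w)), (hV₀.const_min M).const_max (-M), fun w =>
    abs_le.2 ⟨le_max_left _ _, max_le (by linarith) (min_le_left _ _)⟩, fun w hw => ?_⟩
  have h := abs_le.1 (hM w hw)
  simp only
  rw [← hV₀v hw, min_eq_right h.2, max_eq_right h.1]

section
variable {Ω : Set (ℝ × ℝ)} {v g V : ℝ × ℝ → ℝ} {L : NNReal} {M a b c d a₁ b₁ y₁ s₀ s₁ : ℝ}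
  {Γ : ℝ → ℝ → ℝ}

/-- The flux satisfies the weak Euler-Lagrange equation in terms of the intrinsic gradient of a
Lipschitz extension. -/
lemma BurgersMinimizer.integral_flux_mul_firstVariation_eq_zero {U : Set (ℝ × ℝ)}
    (H : BurgersMinimizer Ω v g) (hUo : IsOpen U) (hUΩ : U ⊆ Ω) (hV : LipschitzWith L V)
    (hVv : ∀ w ∈ U, V w = v w) (hM : ∀ w, |V w| ≤ M) {φ : ℝ × ℝ → ℝ} (hφ : ContDiff ℝ 1 φ)
    (hc : HasCompactSupport φ) (hs : tsupport φ ⊆ U) :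
    ∫ w, (lineDeriv ℝ V w (1, 0) - 4 * V w * lineDeriv ℝ V w (0, 1)) /
      √(1 + (lineDeriv ℝ V w (1, 0) - 4 * V w * lineDeriv ℝ V w (0, 1)) ^ 2) *
        firstVariation V φ w = 0 := by
  refine Eq.trans ?_ (H.euler_lagrange hUΩ hV hVv hφ hc hs)
  rw [← setIntegral_eq_integral_of_forall_compl_eq_zero (s := Ω)]
  · refine integral_congr_ae (ae_restrict_of_ae ?_)
    filter_upwards [H.ae_eq_burgers hUo hUΩ hV hVv hM] with w hw
    by_cases hwU : w ∈ U
    · simp only [hw hwU]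
    · simp only [firstVariation_eq_zero fun h => hwU (hs h), mul_zero]
  · intro w hw
    simp only [firstVariation_eq_zero fun h => hw (hUΩ (hs h)), mul_zero]

/-- Along almost every characteristic the function is affine. -/
lemma BurgersMinimizer.ae_affine_char (H : BurgersMinimizer Ω v g)
    (hUΩ : Ioo a b ×ˢ Ioo c d ⊆ Ω) (hV : LipschitzWith L V)
    (hVv : ∀ w ∈ Ioo a b ×ˢ Ioo c d, V w = v w) (hM : ∀ w, |V w| ≤ M)
    (hΓ : IsCharFlow V a b y₁ Γ) (h1 : a₁ < b₁) (hab : Icc a₁ b₁ ⊆ Ioo a b)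
    (hU : ∀ y ∈ Icc a₁ b₁, ∀ s ∈ Ioo s₀ s₁, Γ y s ∈ Ioo c d) :
    ∀ᵐ s, s ∈ Ioo s₀ s₁ → ∃ κ, ∀ y ∈ Icc a₁ b₁,
      V (y, Γ y s) = V (a₁, Γ a₁ s) + κ * (y - a₁) := by
  have cV := hV.continuous
  set f : ℝ × ℝ → ℝ := fun w => lineDeriv ℝ V w (1, 0) - 4 * V w * lineDeriv ℝ V w (0, 1) with hf
  have mf : Measurable f := (measurable_lineDeriv cV).sub
    ((cV.measurable.const_mul 4).mul (measurable_lineDeriv cV))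
  set q : ℝ × ℝ → ℝ := fun w => f w / √(1 + f w ^ 2) with hq
  have mq : Measurable q := mf.div ((mf.pow_const 2).const_add 1).sqrt
  have key := ae_integral_deriv_mul_char_eq_zero hV mq (fun w => abs_div_sqrt_le_one _)
    (fun φ hφ hc hs => H.integral_flux_mul_firstVariation_eq_zero
      (isOpen_Ioo.prod isOpen_Ioo) hUΩ hV hVv hM hφ hc hs) hΓ hab hU
  filter_upwards [key, hΓ.ae_ae hV (hV.ae_differentiableAt (μ := volume))] with s hs hd hsJ
  have cΓ : ContinuousOn (fun y => Γ y s) (Ioo a b) := hΓ.continuousOn s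
  have hM0 : 0 ≤ M := (abs_nonneg _).trans (hM 0)
  set u : ℝ → ℝ := fun y => V (y, Γ y s) with hu
  have lu : LipschitzOnWith (L * max 1 (Real.toNNReal (4 * M))) u (Icc a₁ b₁) := by
    refine LipschitzOnWith.of_dist_le_mul fun x hx y hy => ?_
    refine (hV.dist_le_mul _ _).trans ?_
    push_cast
    rw [mul_assoc, Prod.dist_eq, max_mul_of_nonneg _ _ dist_nonneg, one_mul,
      Real.coe_toNNReal _ (by positivity)]
    refine mul_le_mul_of_nonneg_left (max_le_max le_rfl ?_) L.2
    exact hΓ.abs_sub_base_le hM s (hab hx) (hab hy)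
  set γ : ℝ → ℝ := IccExtend h1.le ((Icc a₁ b₁).domRestrict fun y => Γ y s) with hγ
  have γc : Continuous γ := (continuousOn_iff_continuous_domRestrict.1 (cΓ.mono hab)).Icc_extend'
  have γeq : ∀ y ∈ Icc a₁ b₁, γ y = Γ y s := fun y hy => by
    rw [hγ, IccExtend_of_mem h1.le _ hy, domRestrict_apply]
  obtain ⟨k, hk⟩ := exists_ae_eq_const_of_integral_deriv_mul_eq_zero (f := fun y => q (y, γ y)) h1
    (mq.comp (measurable_id.prodMk γc.measurable)) (fun y => abs_div_sqrt_le_one _) (by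
      intro ω hω hωs
      rw [← hs hsJ ω hω hωs]
      congr 1; ext y
      by_cases hy : y ∈ Icc a₁ b₁
      · rw [γeq y hy]
      · have : deriv ω y = 0 := by
          by_contra h
          exact hy (hωs (support_deriv_subset h))
        rw [this, zero_mul, zero_mul])
  refine ⟨k / √(1 - k ^ 2), fun y hy => lu.eq_affine_of_ae_hasDerivAt h1.le ?_ hy⟩
  filter_upwards [hk, hd] with y hky hdy hyI
  have hyc := Ioo_subset_Icc_self hyI
  have hyab := hab hyc
  have e := hky hyI
  rw [γeq y hyc] at e
  rw [← eq_of_div_sqrt_eq e]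
  have hD := hdy hyab
  have hc : HasDerivAt (fun y => (y, Γ y s)) (1, -4 * V (y, Γ y s)) y :=
    (hasDerivAt_id y).prodMk (hΓ.hasDerivAt s y hyab)
  refine (HasFDerivAt.comp_hasDerivAt y hD.hasFDerivAt hc).congr_deriv ?_
  simp only [hf]
  rw [hD.lineDeriv_eq_fderiv, hD.lineDeriv_eq_fderiv]
  have : ((1, -4 * V (y, Γ y s)) : ℝ × ℝ) = (1, 0) + (-4 * V (y, Γ y s)) • (0, 1) := by
    simp
  rw [this, map_add, map_smul, smul_eq_mul]
  ring

/-- Along every characteristic the intrinsic gradient is constant. -/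
lemma BurgersMinimizer.affine_char (H : BurgersMinimizer Ω v g)
    (hUΩ : Ioo a b ×ˢ Ioo c d ⊆ Ω) (hV : LipschitzWith L V)
    (hVv : ∀ w ∈ Ioo a b ×ˢ Ioo c d, V w = v w) (hM : ∀ w, |V w| ≤ M)
    (hΓ : IsCharFlow V a b y₁ Γ) (h1 : a₁ < b₁) (hab : Icc a₁ b₁ ⊆ Ioo a b)
    (hU : ∀ y ∈ Icc a₁ b₁, ∀ s ∈ Ioo s₀ s₁, Γ y s ∈ Ioo c d) {s : ℝ} (hs : s ∈ Ioo s₀ s₁) :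
    ∃ κ, ∀ y ∈ Icc a₁ b₁, V (y, Γ y s) = V (a₁, Γ a₁ s) + κ * (y - a₁) := by
  have hb0 : b₁ - a₁ ≠ 0 := (sub_pos.2 h1).ne'
  have cΓ : ∀ y ∈ Icc a₁ b₁, Continuous fun s => V (y, Γ y s) := by
    intro y hy
    have : LipschitzWith (Real.toNNReal (Real.exp (4 * L * (b - a)))) fun s => Γ y s :=
      LipschitzWith.of_dist_le_mul fun s s' => by
        rw [Real.coe_toNNReal _ (Real.exp_pos _).le]
        exact hΓ.abs_sub_le hV s' s (hab hy)
    exact hV.continuous.comp (continuous_const.prodMk this.continuous)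
  have ha : a₁ ∈ Icc a₁ b₁ := left_mem_Icc.2 h1.le
  have hb : b₁ ∈ Icc a₁ b₁ := right_mem_Icc.2 h1.le
  refine ⟨(V (b₁, Γ b₁ s) - V (a₁, Γ a₁ s)) / (b₁ - a₁), fun y hy => ?_⟩
  have h2 := H.ae_affine_char hUΩ hV hVv hM hΓ h1 hab hU
  have h3 : (fun s => V (y, Γ y s)) =ᵐ[volume.restrict (Ioo s₀ s₁)] fun s =>
      V (a₁, Γ a₁ s) + (V (b₁, Γ b₁ s) - V (a₁, Γ a₁ s)) / (b₁ - a₁) * (y - a₁) := by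
    rw [Filter.EventuallyEq, ae_restrict_iff' measurableSet_Ioo]
    filter_upwards [h2] with s hs hsJ
    obtain ⟨κ, hκ⟩ := hs hsJ
    rw [hκ y hy, hκ b₁ hb]
    field_simp
    ring
  refine Measure.eqOn_open_of_ae_eq h3 isOpen_Ioo (cΓ y hy).continuousOn ?_ hs
  exact ((cΓ a₁ ha).add ((((cΓ b₁ hb).sub (cΓ a₁ ha)).div_const _).mul_const _)).continuousOn

/-- Characteristics of an intrinsic minimal Lipschitz graph are parabolas, along which the graph
function is affine. -/
lemma BurgersMinimizer.exists_arc (H : BurgersMinimizer Ω v g)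
    (hUΩ : Ioo a b ×ˢ Ioo c d ⊆ Ω) (hv : LipschitzOnWith L v (Ioo a b ×ˢ Ioo c d))
    (hM0 : 0 ≤ M) (hM : ∀ w ∈ Ioo a b ×ˢ Ioo c d, |v w| ≤ M) (ha : a < a₁) (hb : b₁ < b)
    (hy : y₁ ∈ Icc a₁ b₁) {t₁ : ℝ} (h1 : a₁ < b₁) (hc : c < t₁ - 4 * M * (b₁ - a₁))
    (hd : t₁ + 4 * M * (b₁ - a₁) < d) :
    ∃ κ, ∀ y ∈ Icc a₁ b₁,
      (y, t₁ - 4 * v (y₁, t₁) * (y - y₁) - 2 * κ * (y - y₁) ^ 2) ∈ Ioo a b ×ˢ Ioo c d ∧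
      v (y, t₁ - 4 * v (y₁, t₁) * (y - y₁) - 2 * κ * (y - y₁) ^ 2) =
        v (y₁, t₁) + κ * (y - y₁) := by
  have hy₁ : y₁ ∈ Ioo a b := ⟨ha.trans_le hy.1, hy.2.trans_lt hb⟩
  have hab : Icc a₁ b₁ ⊆ Ioo a b := Icc_subset_Ioo ha hb
  obtain ⟨V, hV, hVM, hVv⟩ := hv.exists_bounded_extension hM0 hM
  obtain ⟨Γ, hΓ⟩ := exists_isCharFlow hV hVM hy₁
  have hU : ∀ y ∈ Icc a₁ b₁, ∀ s ∈ Ioo (c + 4 * M * (b₁ - a₁)) (d - 4 * M * (b₁ - a₁)),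
      Γ y s ∈ Ioo c d := by
    intro y hyI s hs
    have h2 := hΓ.abs_sub_base_le hVM s (hab hyI) hy₁
    rw [hΓ.base] at h2
    have h3 : |y - y₁| ≤ b₁ - a₁ := abs_le.2
      ⟨by linarith [hyI.1, hy.2], by linarith [hyI.2, hy.1]⟩
    have h4 := abs_le.1 (h2.trans (mul_le_mul_of_nonneg_left h3 (by positivity)))
    exact ⟨by linarith [h4.1, hs.1], by linarith [h4.2, hs.2]⟩
  have ht : t₁ ∈ Ioo (c + 4 * M * (b₁ - a₁)) (d - 4 * M * (b₁ - a₁)) :=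
    ⟨by linarith, by linarith⟩
  obtain ⟨κ, hκ⟩ := H.affine_char hUΩ hV hVv hVM hΓ h1 hab hU ht
  have hκ₁ := hκ y₁ hy
  rw [hΓ.base] at hκ₁
  have hmem : ∀ y ∈ Icc a₁ b₁, (y, Γ y t₁) ∈ Ioo a b ×ˢ Ioo c d := fun y hyI =>
    ⟨hab hyI, hU y hyI t₁ ht⟩
  have hv₁ : V (y₁, t₁) = v (y₁, t₁) := by
    have := hVv _ (hmem y₁ hy)
    rwa [hΓ.base] at this
  have hval : ∀ y ∈ Icc a₁ b₁, V (y, Γ y t₁) = v (y₁, t₁) + κ * (y - y₁) := fun y hyI => by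
    rw [hκ y hyI, ← hv₁, hκ₁]; ring
  have hparab : ∀ y ∈ Icc a₁ b₁,
      Γ y t₁ = t₁ - 4 * v (y₁, t₁) * (y - y₁) - 2 * κ * (y - y₁) ^ 2 := by
    intro y hyI
    have hd : ∀ z ∈ Icc a₁ b₁, HasDerivWithinAt
        (fun z => Γ z t₁ + 4 * v (y₁, t₁) * (z - y₁) + 2 * κ * (z - y₁) ^ 2) 0 (Icc a₁ b₁) z := by
      intro z hz
      have e0 : HasDerivAt (fun z : ℝ => z - y₁) 1 z := (hasDerivAt_id z).sub_const y₁
      have e1 := ((hΓ.hasDerivAt t₁ z (hab hz)).fun_add (e0.const_mul (4 * v (y₁, t₁)))).fun_add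
        ((e0.fun_pow 2).const_mul (2 * κ))
      refine (e1.congr_deriv ?_).hasDerivWithinAt
      rw [hval z hz]
      push_cast
      ring
    have h5 := (convex_Icc a₁ b₁).norm_image_sub_le_of_norm_hasDerivWithin_le (C := 0) hd
      (fun _ _ => by simp) hy hyI
    rw [zero_mul, norm_le_zero_iff, hΓ.base] at h5
    linarith
  refine ⟨κ, fun y hyI => ?_⟩
  rw [← hparab y hyI]
  exact ⟨hmem y hyI, by rw [← hVv _ (hmem y hyI), hval y hyI]⟩

end

/-- Two affine profiles that stay close, in comparison with the distance of their parabolas, have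
close values and slopes. -/
lemma add_mul_le_of_arc_bounds {a k D h L : ℝ} (hh : 0 < h) (hD : 0 ≤ D) (hL : L * h ≤ 1 / 56)
    (h1 : |a + k * h| ≤ L * (D + 4 * |a| * h + 2 * |k| * h ^ 2))
    (h2 : |a + k * (2 * h)| ≤ L * (D + 4 * |a| * (2 * h) + 2 * |k| * (2 * h) ^ 2)) :
    |a| + |k| * h ≤ D / h := by
  rw [le_div_iff₀ hh]
  set A := |a| with hA
  set B := |k| * h with hB
  have hA0 : 0 ≤ A := abs_nonneg _
  have hB0 : 0 ≤ B := by positivity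
  have e1 : |a + k * h| * h ≤ 1 / 56 * (D + 4 * A * h + 2 * B * h) := by
    calc |a + k * h| * h ≤ L * (D + 4 * A * h + 2 * |k| * h ^ 2) * h := by gcongr
      _ = (L * h) * (D + 4 * A * h + 2 * B * h) := by rw [hB]; ring
      _ ≤ _ := by gcongr
  have e2 : |a + k * (2 * h)| * h ≤ 1 / 56 * (D + 8 * A * h + 8 * B * h) := by
    calc |a + k * (2 * h)| * h ≤ L * (D + 4 * A * (2 * h) + 2 * |k| * (2 * h) ^ 2) * h := by gcongr
      _ = (L * h) * (D + 8 * A * h + 8 * B * h) := by rw [hB]; ring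
      _ ≤ _ := by gcongr
  have e3 : B ≤ |a + k * (2 * h)| + |a + k * h| := by
    have : B = |(a + k * (2 * h)) - (a + k * h)| := by
      rw [hB, ← abs_of_pos hh, ← abs_mul, abs_of_pos hh]; congr 1; ring
    rw [this]; exact abs_sub _ _
  have e4 : A ≤ 2 * |a + k * h| + |a + k * (2 * h)| := by
    have h3 : A = |2 * (a + k * h) - (a + k * (2 * h))| := by rw [hA]; congr 1; ring
    rw [h3]
    refine (abs_sub _ _).trans (le_of_eq ?_)
    rw [abs_mul]; norm_num
  have e5 : A * h ≤ (2 * |a + k * h| + |a + k * (2 * h)|) * h := by gcongr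
  have e6 : B * h ≤ (|a + k * (2 * h)| + |a + k * h|) * h := by gcongr
  nlinarith

/-- If two arcs at the same ordinate lie in a region where `v` is vertically Lipschitz with a small
constant in comparison with the length of the arcs, then their data are Lipschitz related. -/
lemma arc_data_le {v : ℝ × ℝ → ℝ} {y h L t₁ t₂ κ₁ κ₂ : ℝ} (hh : 0 < h) (hL0 : 0 ≤ L)
    (hL : L * h ≤ 1 / 56)
    (hv : ∀ x ∈ ({h, 2 * h} : Set ℝ),
      |v (y + x, t₁ - 4 * v (y, t₁) * x - 2 * κ₁ * x ^ 2) -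
        v (y + x, t₂ - 4 * v (y, t₂) * x - 2 * κ₂ * x ^ 2)| ≤
      L * |(t₁ - 4 * v (y, t₁) * x - 2 * κ₁ * x ^ 2) - (t₂ - 4 * v (y, t₂) * x - 2 * κ₂ * x ^ 2)|)
    (h1 : ∀ x ∈ ({h, 2 * h} : Set ℝ),
      v (y + x, t₁ - 4 * v (y, t₁) * x - 2 * κ₁ * x ^ 2) = v (y, t₁) + κ₁ * x)
    (h2 : ∀ x ∈ ({h, 2 * h} : Set ℝ),
      v (y + x, t₂ - 4 * v (y, t₂) * x - 2 * κ₂ * x ^ 2) = v (y, t₂) + κ₂ * x) :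
    |v (y, t₁) - v (y, t₂)| + |κ₁ - κ₂| * h ≤ |t₁ - t₂| / h := by
  have key : ∀ x ∈ ({h, 2 * h} : Set ℝ), |(v (y, t₁) - v (y, t₂)) + (κ₁ - κ₂) * x| ≤
      L * (|t₁ - t₂| + 4 * |v (y, t₁) - v (y, t₂)| * x + 2 * |κ₁ - κ₂| * x ^ 2) := by
    intro x hx
    have hx0 : 0 ≤ x := by
      rcases hx with rfl | rfl <;> positivity
    have h3 := hv x hx
    rw [h1 x hx, h2 x hx] at h3
    have e : v (y, t₁) - v (y, t₂) + (κ₁ - κ₂) * x =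
      v (y, t₁) + κ₁ * x - (v (y, t₂) + κ₂ * x) := by ring
    rw [e]
    refine h3.trans (mul_le_mul_of_nonneg_left ?_ hL0)
    have e' : t₁ - 4 * v (y, t₁) * x - 2 * κ₁ * x ^ 2 - (t₂ - 4 * v (y, t₂) * x - 2 * κ₂ * x ^ 2)
      = (t₁ - t₂) - 4 * (v (y, t₁) - v (y, t₂)) * x - 2 * (κ₁ - κ₂) * x ^ 2 := by ring
    rw [e']
    refine (abs_sub _ _).trans (add_le_add ((abs_sub _ _).trans (le_of_eq ?_)) (le_of_eq ?_))
    · rw [abs_mul, abs_mul, abs_of_nonneg hx0]; norm_num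
    · rw [abs_mul, abs_mul, abs_of_nonneg (pow_nonneg hx0 2)]; norm_num
  exact add_mul_le_of_arc_bounds hh (abs_nonneg _) hL (key h (by simp)) (key (2 * h) (by simp))

/-- A function that is affine along parabolic arcs leaving a strip is Lipschitz in that strip up to
its boundary, as soon as its Lipschitz constant at distance `b` from it is small compared to
`1 / b`. -/
lemma lipschitzOnWith_of_arcs {v : ℝ × ℝ → ℝ} {y₀ t₀ b L M r τ : ℝ} (hb : 0 < b) (hL0 : 0 ≤ L)
    (hM0 : 0 ≤ M) (hL : L * b ≤ 1 / 56) (hMb : 6 * M * b ≤ τ / 2)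
    (hv : ∀ y ∈ Icc (y₀ + b) (y₀ + 3 * b), ∀ t ∈ Ioo (t₀ - r) (t₀ + r),
      ∀ t' ∈ Ioo (t₀ - r) (t₀ + r), |v (y, t) - v (y, t')| ≤ L * |t - t'|)
    (harc : ∀ η ∈ Ioc 0 b, ∀ t ∈ Icc (t₀ - τ) (t₀ + τ), ∃ κ, ∀ x ∈ Icc 0 (2 * b),
      t - 4 * v (y₀ + η, t) * x - 2 * κ * x ^ 2 ∈ Ioo (t₀ - r) (t₀ + r) ∧
      v (y₀ + η + x, t - 4 * v (y₀ + η, t) * x - 2 * κ * x ^ 2) = v (y₀ + η, t) + κ * x ∧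
      |v (y₀ + η, t) + κ * x| ≤ M) :
    LipschitzOnWith (Real.toNNReal ((1 + 7 * M) / b)) v
      (Ioc y₀ (y₀ + b) ×ˢ Icc (t₀ - τ / 2) (t₀ + τ / 2)) := by
  have hτ : 0 ≤ τ := by nlinarith [mul_nonneg hM0 hb.le]
  have vert : ∀ η ∈ Ioc 0 b, ∀ t ∈ Icc (t₀ - τ) (t₀ + τ), ∀ t' ∈ Icc (t₀ - τ) (t₀ + τ),
      |v (y₀ + η, t) - v (y₀ + η, t')| ≤ |t - t'| / b := by
    intro η hη t ht t' ht'
    obtain ⟨κ, hκ⟩ := harc η hη t ht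
    obtain ⟨κ', hκ'⟩ := harc η hη t' ht'
    have hx : ∀ x ∈ ({b, 2 * b} : Set ℝ), x ∈ Icc 0 (2 * b) ∧
        y₀ + η + x ∈ Icc (y₀ + b) (y₀ + 3 * b) := by
      rintro x (rfl | rfl)
      · exact ⟨⟨hb.le, by linarith⟩, by linarith [hη.1], by linarith [hη.2]⟩
      · exact ⟨⟨by linarith, by linarith⟩, by linarith [hη.1], by linarith [hη.2]⟩
    have := arc_data_le (v := v) (y := y₀ + η) (t₁ := t) (t₂ := t') (κ₁ := κ) (κ₂ := κ') hb hL0 hL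
      (fun x hxb => hv _ (hx x hxb).2 _ (hκ x (hx x hxb).1).1 _ (hκ' x (hx x hxb).1).1)
      (fun x hxb => (hκ x (hx x hxb).1).2.1) (fun x hxb => (hκ' x (hx x hxb).1).2.1)
    have h0 : 0 ≤ |κ - κ'| * b := by positivity
    linarith
  have horiz : ∀ η ∈ Ioc 0 b, ∀ η' ∈ Ioc 0 b, η ≤ η' → ∀ t ∈ Icc (t₀ - τ / 2) (t₀ + τ / 2),
      |v (y₀ + η', t) - v (y₀ + η, t)| ≤ 7 * M / b * |η' - η| := by
    intro η hη η' hη' hle t ht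
    obtain ⟨κ, hκ⟩ := harc η hη t ⟨by linarith [ht.1], by linarith [ht.2]⟩
    set x := η' - η with hx
    have hx0 : 0 ≤ x := sub_nonneg.2 hle
    have hxb : x ≤ b := by linarith [hη.1, hη'.2]
    have hv0 : |v (y₀ + η, t)| ≤ M := by simpa using (hκ 0 ⟨le_rfl, by linarith⟩).2.2
    have hκM : |κ| * b ≤ M := by
      have h1 := (hκ (2 * b) ⟨by linarith, le_rfl⟩).2.2
      have h2 : |κ * (2 * b)| ≤ M + M := by
        have : κ * (2 * b) = v (y₀ + η, t) + κ * (2 * b) - v (y₀ + η, t) := by ring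
        rw [this]
        exact (abs_sub _ _).trans (add_le_add h1 hv0)
      rw [abs_mul, abs_of_pos (by linarith : 0 < 2 * b)] at h2
      linarith
    obtain ⟨-, h2, -⟩ := hκ x ⟨hx0, by linarith⟩
    set t' := t - 4 * v (y₀ + η, t) * x - 2 * κ * x ^ 2 with ht'
    have hκx : |κ| * x ≤ M / b * x := by
      gcongr
      rwa [le_div_iff₀ hb]
    have htt : |t - t'| ≤ 6 * M * x := by
      have : t - t' = 4 * v (y₀ + η, t) * x + 2 * κ * x * x := by rw [ht']; ring
      rw [this]
      refine (abs_add_le _ _).trans ?_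
      rw [abs_mul, abs_mul, abs_mul, abs_mul, abs_mul, abs_of_nonneg hx0]
      norm_num
      have h3 : |κ| * x ≤ |κ| * b := by gcongr
      have h4 : |v (y₀ + η, t)| * x ≤ M * x := by gcongr
      have h5 : |κ| * x * x ≤ M * x := by gcongr; linarith
      linarith
    have htt' : 6 * M * x ≤ τ / 2 := le_trans (by gcongr) hMb
    have htm : t' ∈ Icc (t₀ - τ) (t₀ + τ) := by
      have := abs_le.1 (htt.trans htt')
      constructor <;> linarith [ht.1, ht.2, this.1, this.2]
    have h3 := vert η' hη' t ⟨by linarith [ht.1], by linarith [ht.2]⟩ t' htm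
    have e : y₀ + η + x = y₀ + η' := by rw [hx]; ring
    rw [e] at h2
    have e2 : v (y₀ + η', t) - v (y₀ + η, t) =
      (v (y₀ + η', t) - v (y₀ + η', t')) + κ * x := by rw [h2]; ring
    rw [e2, abs_of_nonneg hx0]
    refine (abs_add_le _ _).trans ?_
    rw [abs_mul, abs_of_nonneg hx0]
    have h6 : |t - t'| / b ≤ 6 * M * x / b := by gcongr
    have h7 : 7 * M / b * x = 6 * M * x / b + M / b * x := by ring
    linarith
  have main : ∀ w ∈ Ioc y₀ (y₀ + b) ×ˢ Icc (t₀ - τ / 2) (t₀ + τ / 2),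
      ∀ w' ∈ Ioc y₀ (y₀ + b) ×ˢ Icc (t₀ - τ / 2) (t₀ + τ / 2), w.1 ≤ w'.1 →
      dist (v w) (v w') ≤ (1 + 7 * M) / b * dist w w' := by
    rintro ⟨y, t⟩ ⟨hy, ht⟩ ⟨y', t'⟩ ⟨hy', ht'⟩ hle
    simp only at hy ht hy' ht' hle
    have m : y - y₀ ∈ Ioc 0 b := ⟨by linarith [hy.1], by linarith [hy.2]⟩
    have m' : y' - y₀ ∈ Ioc 0 b := ⟨by linarith [hy'.1], by linarith [hy'.2]⟩
    have h1 := horiz _ m _ m' (by linarith) t ht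
    have h2 := vert _ m' t ⟨by linarith [ht.1], by linarith [ht.2]⟩ t'
      ⟨by linarith [ht'.1], by linarith [ht'.2]⟩
    simp only [add_sub_cancel, sub_sub_sub_cancel_right] at h1 h2
    rw [Prod.dist_eq, Real.dist_eq]
    simp only [Real.dist_eq]
    have e : v (y, t) - v (y', t') = (v (y', t) - v (y', t')) - (v (y', t) - v (y, t)) := by ring
    rw [e]
    refine (abs_sub _ _).trans ?_
    rw [abs_sub_comm y' y] at h1
    have h3 : 7 * M / b * |y - y'| ≤ 7 * M / b * max |y - y'| |t - t'| := by
      gcongr; exact le_max_left _ _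
    have h4 : |t - t'| / b ≤ 1 / b * max |y - y'| |t - t'| := by
      rw [div_eq_mul_one_div, mul_comm]
      gcongr; exact le_max_right _ _
    have h5 : (1 + 7 * M) / b = 1 / b + 7 * M / b := by ring
    rw [h5, add_mul]
    linarith
  refine LipschitzOnWith.of_dist_le_mul fun w hw w' hw' => ?_
  rw [Real.coe_toNNReal _ (by positivity)]
  rcases le_total w.1 w'.1 with h | h
  · exact main w hw w' hw' h
  · rw [dist_comm, dist_comm w]
    exact main w' hw' w hw h

/-- A continuous function which is Lipschitz on both sides of a vertical line is Lipschitz. -/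
lemma lipschitzOnWith_of_halves {v : ℝ × ℝ → ℝ} {y₀ t₀ b τ : ℝ} {K : NNReal} (hb : 0 < b)
    (hc : ContinuousOn v (Icc (y₀ - b) (y₀ + b) ×ˢ Icc (t₀ - τ) (t₀ + τ)))
    (h1 : LipschitzOnWith K v (Ioc y₀ (y₀ + b) ×ˢ Icc (t₀ - τ) (t₀ + τ)))
    (h2 : LipschitzOnWith K v (Ico (y₀ - b) y₀ ×ˢ Icc (t₀ - τ) (t₀ + τ))) :
    LipschitzOnWith (2 * K) v (Icc (y₀ - b) (y₀ + b) ×ˢ Icc (t₀ - τ) (t₀ + τ)) := by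
  have e1 : closure (Ioc y₀ (y₀ + b) ×ˢ Icc (t₀ - τ) (t₀ + τ)) =
      Icc y₀ (y₀ + b) ×ˢ Icc (t₀ - τ) (t₀ + τ) := by
    rw [closure_prod_eq, closure_Ioc (by linarith), isClosed_Icc.closure_eq]
  have e2 : closure (Ico (y₀ - b) y₀ ×ˢ Icc (t₀ - τ) (t₀ + τ)) =
      Icc (y₀ - b) y₀ ×ˢ Icc (t₀ - τ) (t₀ + τ) := by
    rw [closure_prod_eq, closure_Ico (by linarith), isClosed_Icc.closure_eq]
  have h1' : LipschitzOnWith K v (Icc y₀ (y₀ + b) ×ˢ Icc (t₀ - τ) (t₀ + τ)) := by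
    rw [← e1]
    refine h1.closure (hc.mono ?_)
    rw [e1]
    exact prod_mono_left (Icc_subset_Icc_left (by linarith))
  have h2' : LipschitzOnWith K v (Icc (y₀ - b) y₀ ×ˢ Icc (t₀ - τ) (t₀ + τ)) := by
    rw [← e2]
    refine h2.closure (hc.mono ?_)
    rw [e2]
    exact prod_mono_left (Icc_subset_Icc_right (by linarith))
  have main : ∀ w ∈ Icc (y₀ - b) (y₀ + b) ×ˢ Icc (t₀ - τ) (t₀ + τ),
      ∀ w' ∈ Icc (y₀ - b) (y₀ + b) ×ˢ Icc (t₀ - τ) (t₀ + τ), w.1 ≤ w'.1 →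
      dist (v w) (v w') ≤ 2 * K * dist w w' := by
    rintro ⟨y, t⟩ ⟨hy, ht⟩ ⟨y', t'⟩ ⟨hy', ht'⟩ hle
    simp only at hy ht hy' ht' hle
    have hK : (K : ℝ) * dist (y, t) (y', t') ≤ 2 * K * dist (y, t) (y', t') := by
      have : 0 ≤ (K : ℝ) * dist (y, t) (y', t') := by positivity
      linarith
    rcases le_total y₀ y with h | h
    · exact (h1'.dist_le_mul (y, t) ⟨⟨h, hy.2⟩, ht⟩ (y', t') ⟨⟨h.trans hle, hy'.2⟩, ht'⟩).trans hK
    rcases le_total y' y₀ with h' | h'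
    · exact (h2'.dist_le_mul (y, t) ⟨⟨hy.1, h⟩, ht⟩ (y', t') ⟨⟨hy'.1, h'⟩, ht'⟩).trans hK
    have m1 := h2'.dist_le_mul (y, t) ⟨⟨hy.1, h⟩, ht⟩ (y₀, t) ⟨⟨by linarith, le_rfl⟩, ht⟩
    have m2 := h1'.dist_le_mul (y₀, t) ⟨⟨le_rfl, by linarith⟩, ht⟩ (y', t') ⟨⟨h', hy'.2⟩, ht'⟩
    have d1 : dist (y, t) (y₀, t) ≤ dist (y, t) (y', t') := by
      rw [Prod.dist_eq, Prod.dist_eq, dist_self, max_eq_left dist_nonneg]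
      refine le_trans ?_ (le_max_left _ _)
      simp only [Real.dist_eq]
      rw [abs_sub_comm y, abs_sub_comm y, abs_of_nonneg (by linarith), abs_of_nonneg (by linarith)]
      linarith
    have d2 : dist (y₀, t) (y', t') ≤ dist (y, t) (y', t') := by
      rw [Prod.dist_eq, Prod.dist_eq]
      refine max_le_max ?_ le_rfl
      simp only [Real.dist_eq]
      rw [abs_sub_comm y, abs_sub_comm y₀, abs_of_nonneg (by linarith),
        abs_of_nonneg (by linarith)]
      linarith
    refine (dist_triangle _ (v (y₀, t)) _).trans ?_
    have d1' : (K : ℝ) * dist (y, t) (y₀, t) ≤ K * dist (y, t) (y', t') := by gcongr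
    have d2' : (K : ℝ) * dist (y₀, t) (y', t') ≤ K * dist (y, t) (y', t') := by gcongr
    linarith
  refine LipschitzOnWith.of_dist_le_mul fun w hw w' hw' => ?_
  push_cast
  rcases le_total w.1 w'.1 with h | h
  · exact main w hw w' hw' h
  · rw [dist_comm, dist_comm w]
    exact main w' hw' w hw h

section
variable {Ω : Set (ℝ × ℝ)} {v g : ℝ × ℝ → ℝ} {y₀ t₀ r ρ₀ M b : ℝ}

/-- The one-sided Lipschitz estimate to the right of a point. -/
lemma BurgersMinimizer.lipschitzOnWith_right (H : BurgersMinimizer Ω v g)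
    (hr : Ioo (y₀ - r) (y₀ + r) ×ˢ Ioo (t₀ - r) (t₀ + r) ⊆ Ω) (hM0 : 0 ≤ M)
    (hM : ∀ w ∈ Ioo (y₀ - r) (y₀ + r) ×ˢ Ioo (t₀ - r) (t₀ + r), |v w| ≤ M)
    (hv : ∀ ρ, 0 < ρ → ρ < ρ₀ → ∃ L : NNReal, ρ * (L : ℝ) ≤ 1 / 56 ∧
      LipschitzOnWith L v (Ico (y₀ + ρ) (y₀ + r) ×ˢ Ioo (t₀ - r) (t₀ + r)))
    (hb : 0 < b) (hbρ : b < ρ₀) (hbr : 24 * (M + 1) * b ≤ r) :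
    LipschitzOnWith (Real.toNNReal ((1 + 7 * M) / b)) v
      (Ioc y₀ (y₀ + b) ×ˢ Icc (t₀ - r / 2 / 2) (t₀ + r / 2 / 2)) := by
  have hMb : 0 ≤ M * b := by positivity
  obtain ⟨L, hL, hLv⟩ := hv b hb hbρ
  refine lipschitzOnWith_of_arcs (L := L) (M := M) (r := r) hb L.2 hM0 (by linarith)
    (by linarith) ?_ ?_
  · intro y hy t ht t' ht'
    have hyr : y ∈ Ico (y₀ + b) (y₀ + r) := ⟨hy.1, by linarith [hy.2]⟩
    have := hLv.dist_le_mul (y, t) ⟨hyr, ht⟩ (y, t') ⟨hyr, ht'⟩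
    rwa [Prod.dist_eq, dist_self, max_eq_right dist_nonneg, Real.dist_eq, Real.dist_eq] at this
  · intro η hη t ht
    obtain ⟨L', -, hL'⟩ := hv (η / 2) (by linarith [hη.1]) (by linarith [hη.1, hη.2])
    have hsub : Ioo (y₀ + η / 2) (y₀ + r) ×ˢ Ioo (t₀ - r) (t₀ + r) ⊆
        Ioo (y₀ - r) (y₀ + r) ×ˢ Ioo (t₀ - r) (t₀ + r) :=
      prod_mono_left (Ioo_subset_Ioo_left (by linarith [hη.1]))
    obtain ⟨κ, hκ⟩ := H.exists_arc (a₁ := y₀ + η) (b₁ := y₀ + η + 2 * b) (y₁ := y₀ + η) (t₁ := t)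
      (hsub.trans hr) (hL'.mono (prod_mono_left Ioo_subset_Ico_self)) hM0
      (fun w hw => hM w (hsub hw)) (by linarith [hη.1]) (by linarith [hη.2])
      ⟨le_rfl, by linarith⟩ (by linarith) (by linarith [ht.1]) (by linarith [ht.2])
    refine ⟨κ, fun x hx => ?_⟩
    obtain ⟨h1, h2⟩ := hκ (y₀ + η + x) ⟨by linarith [hx.1], by linarith [hx.2]⟩
    rw [add_sub_cancel_left] at h1 h2
    refine ⟨h1.2, h2, ?_⟩
    rw [← h2]
    exact hM _ (hsub h1)

/-- The one-sided Lipschitz estimate to the left of a point. -/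
lemma BurgersMinimizer.lipschitzOnWith_left (H : BurgersMinimizer Ω v g)
    (hr : Ioo (y₀ - r) (y₀ + r) ×ˢ Ioo (t₀ - r) (t₀ + r) ⊆ Ω) (hM0 : 0 ≤ M)
    (hM : ∀ w ∈ Ioo (y₀ - r) (y₀ + r) ×ˢ Ioo (t₀ - r) (t₀ + r), |v w| ≤ M)
    (hv : ∀ ρ, 0 < ρ → ρ < ρ₀ → ∃ L : NNReal, ρ * (L : ℝ) ≤ 1 / 56 ∧
      LipschitzOnWith L v (Ioc (y₀ - r) (y₀ - ρ) ×ˢ Ioo (t₀ - r) (t₀ + r)))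
    (hb : 0 < b) (hbρ : b < ρ₀) (hbr : 24 * (M + 1) * b ≤ r) :
    LipschitzOnWith (Real.toNNReal ((1 + 7 * M) / b)) v
      (Ico (y₀ - b) y₀ ×ˢ Icc (t₀ - r / 2 / 2) (t₀ + r / 2 / 2)) := by
  have hMb : 0 ≤ M * b := by positivity
  obtain ⟨L, hL, hLv⟩ := hv b hb hbρ
  have key := lipschitzOnWith_of_arcs (v := fun w => -v (2 * y₀ - w.1, w.2)) (y₀ := y₀) (t₀ := t₀)
    (L := L) (M := M) (r := r) (τ := r / 2) hb L.2 hM0 (by linarith) (by linarith) ?_ ?_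
  · refine LipschitzOnWith.of_dist_le_mul fun w hw w' hw' => ?_
    have := key.dist_le_mul (2 * y₀ - w.1, w.2)
      ⟨⟨by linarith [hw.1.2], by linarith [hw.1.1]⟩, hw.2⟩ (2 * y₀ - w'.1, w'.2)
      ⟨⟨by linarith [hw'.1.2], by linarith [hw'.1.1]⟩, hw'.2⟩
    simp only [sub_sub_cancel, dist_neg_neg] at this
    rw [Prod.dist_eq] at this ⊢
    rwa [dist_sub_left] at this
  · intro y hy t ht t' ht'
    have hyr : 2 * y₀ - y ∈ Ioc (y₀ - r) (y₀ - b) := ⟨by linarith [hy.2], by linarith [hy.1]⟩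
    have := hLv.dist_le_mul (2 * y₀ - y, t) ⟨hyr, ht⟩ (2 * y₀ - y, t') ⟨hyr, ht'⟩
    rw [Prod.dist_eq, dist_self, max_eq_right dist_nonneg, Real.dist_eq, Real.dist_eq] at this
    rwa [neg_sub_neg, abs_sub_comm]
  · intro η hη t ht
    obtain ⟨L', -, hL'⟩ := hv (η / 2) (by linarith [hη.1]) (by linarith [hη.1, hη.2])
    have hsub : Ioo (y₀ - r) (y₀ - η / 2) ×ˢ Ioo (t₀ - r) (t₀ + r) ⊆
        Ioo (y₀ - r) (y₀ + r) ×ˢ Ioo (t₀ - r) (t₀ + r) :=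
      prod_mono_left (Ioo_subset_Ioo_right (by linarith [hη.1]))
    obtain ⟨κ, hκ⟩ := H.exists_arc (a₁ := y₀ - η - 2 * b) (b₁ := y₀ - η) (y₁ := y₀ - η) (t₁ := t)
      (hsub.trans hr) (hL'.mono (prod_mono_left Ioo_subset_Ioc_self)) hM0
      (fun w hw => hM w (hsub hw)) (by linarith [hη.2]) (by linarith [hη.1])
      ⟨by linarith, le_rfl⟩ (by linarith) (by linarith [ht.1]) (by linarith [ht.2])
    refine ⟨κ, fun x hx => ?_⟩
    obtain ⟨h1, h2⟩ := hκ (y₀ - η - x) ⟨by linarith [hx.2], by linarith [hx.1]⟩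
    have e1 : y₀ - η - x - (y₀ - η) = -x := by ring
    have e2 : 2 * y₀ - (y₀ + η) = y₀ - η := by ring
    have e3 : 2 * y₀ - (y₀ + η + x) = y₀ - η - x := by ring
    have e4 : t - 4 * v (y₀ - η, t) * -x - 2 * κ * (-x) ^ 2 =
      t - 4 * -v (y₀ - η, t) * x - 2 * κ * x ^ 2 := by ring
    rw [e1, e4] at h1 h2
    simp only [e2, e3]
    have h3 := hM _ (hsub h1)
    rw [h2] at h3 ⊢
    refine ⟨h1.2, by ring, ?_⟩
    rw [← abs_neg] at h3
    refine le_trans (le_of_eq ?_) h3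
    congr 1; ring

/-- A minimizer whose Lipschitz constant outside the lenses is negligible is locally Lipschitz. -/
lemma BurgersMinimizer.exists_lipschitzOnWith_ball (H : BurgersMinimizer Ω v g) {w₀ : ℝ × ℝ}
    (hr0 : 0 < r) (hr : Metric.closedBall w₀ r ⊆ Ω)
    (hs : ∀ ε > (0:ℝ), ∃ ρ₀ : ℝ, 0 < ρ₀ ∧ ρ₀ < r ∧ ∀ ρ : ℝ, 0 < ρ → ρ < ρ₀ →
        ∃ L : NNReal, ρ * (L : ℝ) ≤ ε ∧
          LipschitzOnWith L v ({w ∈ Metric.ball w₀ r | w₀.1 < w.1} \ lensDr w₀ r ρ) ∧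
          LipschitzOnWith L v ({w ∈ Metric.ball w₀ r | w.1 < w₀.1} \ lensDr w₀ r ρ)) :
    ∃ ε > (0:ℝ), ∃ K : NNReal, Metric.ball w₀ ε ⊆ Ω ∧ LipschitzOnWith K v (Metric.ball w₀ ε) := by
  obtain ⟨y₀, t₀⟩ := w₀
  obtain ⟨ρ₀, hρ0, hρr, hρ⟩ := hs (1 / 56) (by norm_num)
  obtain ⟨M, hM⟩ := (isCompact_closedBall (y₀, t₀) r).exists_bound_of_continuousOn
    (H.continuousOn.mono hr)
  have hM0 : 0 ≤ M := (norm_nonneg _).trans (hM _ (Metric.mem_closedBall_self hr0.le))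
  have hball : ∀ δ : ℝ, Metric.ball (y₀, t₀) δ =
      Ioo (y₀ - δ) (y₀ + δ) ×ˢ Ioo (t₀ - δ) (t₀ + δ) := fun δ => by
    rw [← ball_prod_same, Real.ball_eq_Ioo, Real.ball_eq_Ioo]
  have hsub : Ioo (y₀ - r) (y₀ + r) ×ˢ Ioo (t₀ - r) (t₀ + r) ⊆ Metric.closedBall (y₀, t₀) r := by
    rw [← hball]; exact Metric.ball_subset_closedBall
  have hlens : ∀ ρ, 0 < ρ → ∀ w : ℝ × ℝ, ρ ≤ |w.1 - y₀| → w ∉ lensDr (y₀, t₀) r ρ := by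
    rintro ρ hρ w hw ⟨-, h⟩
    refine absurd h (not_lt.2 (le_trans ?_ hw))
    simp only
    rw [mul_assoc, div_mul_eq_mul_div, div_le_iff₀ (by positivity)]
    refine mul_le_mul_of_nonneg_left ?_ hρ.le
    nlinarith [sq_nonneg (w.2 - t₀)]
  set b := min (ρ₀ / 2) (r / (24 * (M + 1))) with hb
  have hb0 : 0 < b := by positivity
  have hbρ : b < ρ₀ := (min_le_left _ _).trans_lt (by linarith)
  have hbr : 24 * (M + 1) * b ≤ r := by
    have := min_le_right (ρ₀ / 2) (r / (24 * (M + 1)))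
    rw [le_div_iff₀ (by positivity)] at this
    linarith
  have hM' : ∀ w ∈ Ioo (y₀ - r) (y₀ + r) ×ˢ Ioo (t₀ - r) (t₀ + r), |v w| ≤ M :=
    fun w hw => hM w (hsub hw)
  have h1 := H.lipschitzOnWith_right (hsub.trans hr) hM0 hM' (ρ₀ := ρ₀) (fun ρ h0 h => by
    obtain ⟨L, hL, hL1, -⟩ := hρ ρ h0 h
    refine ⟨L, hL, hL1.mono fun w hw => ⟨⟨?_, ?_⟩, hlens ρ h0 w ?_⟩⟩
    · rw [hball]; exact ⟨⟨by linarith [hw.1.1], hw.1.2⟩, hw.2⟩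
    · simp only; linarith [hw.1.1]
    · exact le_trans (by linarith [hw.1.1]) (le_abs_self _)) hb0 hbρ hbr
  have h2 := H.lipschitzOnWith_left (hsub.trans hr) hM0 hM' (ρ₀ := ρ₀) (fun ρ h0 h => by
    obtain ⟨L, hL, -, hL1⟩ := hρ ρ h0 h
    refine ⟨L, hL, hL1.mono fun w hw => ⟨⟨?_, ?_⟩, hlens ρ h0 w ?_⟩⟩
    · rw [hball]; exact ⟨⟨hw.1.1, by linarith [hw.1.2]⟩, hw.2⟩
    · simp only; linarith [hw.1.2]
    · exact le_trans (by linarith [hw.1.2]) (neg_le_abs _)) hb0 hbρ hbr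
  have hMb : 0 ≤ M * b := by positivity
  have h3 := lipschitzOnWith_of_halves hb0 (H.continuousOn.mono ?_) h1 h2
  · have hb4 : b ≤ r / 2 / 2 := by linarith
    refine ⟨b, hb0, _, ?_, h3.mono ?_⟩
    · exact (Metric.ball_subset_closedBall.trans (Metric.closedBall_subset_closedBall
        (by linarith))).trans hr
    · rw [hball]
      exact prod_mono Ioo_subset_Icc_self
        (Ioo_subset_Icc_self.trans (Icc_subset_Icc (by linarith) (by linarith)))
  · refine Subset.trans ?_ (hsub.trans hr)
    exact prod_mono (Icc_subset_Ioo (by linarith) (by linarith))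
      (Icc_subset_Ioo (by linarith) (by linarith))

end

/-- The parabola issued from `w` along which `v` is affine when it has slope `κ`. -/
def parabolicArc (v : ℝ × ℝ → ℝ) (w : ℝ × ℝ) (κ x : ℝ) : ℝ × ℝ :=
  (w.1 + x, w.2 - 4 * v w * x - 2 * κ * x ^ 2)

/-- The function `v` is affine of slope `κ` along the parabola issued from `w`. -/
def HasArcSlope (v : ℝ × ℝ → ℝ) (w : ℝ × ℝ) (κ : ℝ) : Prop :=
  ∀ᶠ x in 𝓝 0, v (parabolicArc v w κ x) = v w + κ * x

open Classical in
/-- The slope of `v` along the parabola through a point. -/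
def arcSlope (v : ℝ × ℝ → ℝ) (w : ℝ × ℝ) : ℝ :=
  if h : ∃ κ, HasArcSlope v w κ then h.choose else 0

section
variable {Ω U : Set (ℝ × ℝ)} {v g : ℝ × ℝ → ℝ} {w w₀ : ℝ × ℝ} {K : NNReal} {κ κ' ε : ℝ}

lemma parabolicArc_zero : parabolicArc v w κ 0 = w := by simp [parabolicArc]

lemma hasDerivAt_parabolicArc : HasDerivAt (parabolicArc v w κ) (1, -4 * v w) 0 := by
  have e0 : HasDerivAt (fun x : ℝ => x) 1 0 := hasDerivAt_id 0
  have e1 := e0.const_add w.1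
  have e2 := ((e0.const_mul (4 * v w)).const_sub w.2).sub ((e0.fun_pow 2).const_mul (2 * κ))
  exact (e1.prodMk e2).congr_deriv (by simp)

lemma eventually_parabolicArc_mem (hU : U ∈ 𝓝 w) : ∀ᶠ x in 𝓝 0, parabolicArc v w κ x ∈ U := by
  have h := (hasDerivAt_parabolicArc (v := v) (w := w) (κ := κ)).continuousAt
  rw [ContinuousAt, parabolicArc_zero] at h
  exact h.eventually hU

lemma HasArcSlope.unique (hU : U ∈ 𝓝 w) (hv : LipschitzOnWith K v U) (h : HasArcSlope v w κ)
    (h' : HasArcSlope v w κ') : κ = κ' := by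
  by_contra hne
  have hpos : 0 < |κ - κ'| := abs_pos.2 (sub_ne_zero.2 hne)
  have hsmall : ∀ᶠ x : ℝ in 𝓝 0, 2 * K * x < 1 := by
    have : Continuous fun x : ℝ => 2 * K * x := by fun_prop
    exact this.continuousAt.eventually (gt_mem_nhds (by simp))
  have hall := (((h.and h').and ((eventually_parabolicArc_mem hU (v := v) (κ := κ)).and
    (eventually_parabolicArc_mem hU (v := v) (κ := κ')))).and hsmall)
  obtain ⟨x, ⟨⟨⟨e, e'⟩, m, m'⟩, hx⟩, hx0⟩ :=
    ((hall.filter_mono nhdsWithin_le_nhds).and (self_mem_nhdsWithin (s := Ioi (0 : ℝ)))).exists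
  have hx0 : 0 < x := hx0
  have hd := hv.dist_le_mul _ m _ m'
  rw [e, e', Prod.dist_eq] at hd
  simp only [parabolicArc, dist_self, Real.dist_eq] at hd
  rw [max_eq_right (abs_nonneg _)] at hd
  have e1 : v w + κ * x - (v w + κ' * x) = (κ - κ') * x := by ring
  have e2 : w.2 - 4 * v w * x - 2 * κ * x ^ 2 - (w.2 - 4 * v w * x - 2 * κ' * x ^ 2) =
    (κ - κ') * (-2 * x ^ 2) := by ring
  rw [e1, e2, abs_mul, abs_mul, abs_of_pos hx0, abs_mul, abs_of_nonneg (sq_nonneg x)] at hd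
  norm_num at hd
  have : 0 < |κ - κ'| * x := by positivity
  nlinarith

lemma HasArcSlope.arcSlope_eq (hU : U ∈ 𝓝 w) (hv : LipschitzOnWith K v U)
    (h : HasArcSlope v w κ) : arcSlope v w = κ := by
  have hex : ∃ κ, HasArcSlope v w κ := ⟨κ, h⟩
  rw [arcSlope, dif_pos hex]
  exact hex.choose_spec.unique hU hv h

/-- Near every point, `v` is affine along parabolas of a uniform length. -/
lemma BurgersMinimizer.exists_uniform_arcs (H : BurgersMinimizer Ω v g) (hε : 0 < ε)
    (hΩ : Metric.ball w₀ ε ⊆ Ω) (hv : LipschitzOnWith K v (Metric.ball w₀ ε)) :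
    ∃ M ≥ 0, ∃ h > 0, (K : ℝ) * h ≤ 1 / 56 ∧ (∀ w ∈ Metric.ball w₀ ε, |v w| ≤ M) ∧
      ∀ w ∈ Metric.ball w₀ (ε / 2), ∃ κ, ∀ x ∈ Icc (-(2 * h)) (2 * h),
        parabolicArc v w κ x ∈ Metric.ball w₀ ε ∧
          v (parabolicArc v w κ x) = v w + κ * x := by
  obtain ⟨y₀, t₀⟩ := w₀
  have hball : ∀ δ : ℝ, Metric.ball (y₀, t₀) δ =
      Ioo (y₀ - δ) (y₀ + δ) ×ˢ Ioo (t₀ - δ) (t₀ + δ) := fun δ => by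
    rw [← ball_prod_same, Real.ball_eq_Ioo, Real.ball_eq_Ioo]
  set M := |v (y₀, t₀)| + K * ε with hMdef
  have hM : ∀ w ∈ Metric.ball (y₀, t₀) ε, |v w| ≤ M := by
    intro w hw
    have h1 := hv.dist_le_mul w hw _ (Metric.mem_ball_self hε)
    rw [Real.dist_eq] at h1
    have h2 : (K : ℝ) * dist w (y₀, t₀) ≤ K * ε := by gcongr; exact (Metric.mem_ball.1 hw).le
    have h3 : |v w| ≤ |v w - v (y₀, t₀)| + |v (y₀, t₀)| := by
      have := abs_add_le (v w - v (y₀, t₀)) (v (y₀, t₀))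
      rwa [sub_add_cancel] at this
    linarith
  have hM0 : 0 ≤ M := by positivity
  set h := min (1 / (56 * ((K : ℝ) + 1))) (ε / (34 * (M + 1))) with hh
  have hh0 : 0 < h := by positivity
  have hK : (K : ℝ) * h ≤ 1 / 56 := by
    have h1 := min_le_left (1 / (56 * ((K : ℝ) + 1))) (ε / (34 * (M + 1)))
    rw [← hh, le_div_iff₀ (by positivity)] at h1
    linarith
  have hMh : 34 * (M + 1) * h ≤ ε := by
    have h1 := min_le_right (1 / (56 * ((K : ℝ) + 1))) (ε / (34 * (M + 1)))
    rw [← hh, le_div_iff₀ (by positivity)] at h1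
    linarith
  have hMh0 : 0 ≤ M * h := by positivity
  refine ⟨M, hM0, h, hh0, hK, hM, fun w hw => ?_⟩
  rw [hball] at hw hΩ hv hM
  obtain ⟨κ, hκ⟩ := H.exists_arc (a₁ := w.1 - 2 * h) (b₁ := w.1 + 2 * h) (y₁ := w.1) (t₁ := w.2)
    hΩ hv hM0 hM (by linarith [hw.1.1]) (by linarith [hw.1.2]) ⟨by linarith, by linarith⟩
    (by linarith) (by linarith [hw.2.1]) (by linarith [hw.2.2])
  refine ⟨κ, fun x hx => ?_⟩
  have := hκ (w.1 + x) ⟨by linarith [hx.1], by linarith [hx.2]⟩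
  rw [add_sub_cancel_left] at this
  rw [hball]
  exact this

lemma hasArcSlope_of_forall_mem_Icc {h : ℝ} (hh : 0 < h)
    (hκ : ∀ x ∈ Icc (-(2 * h)) (2 * h), v (parabolicArc v w κ x) = v w + κ * x) :
    HasArcSlope v w κ := by
  filter_upwards [Icc_mem_nhds (by linarith : -(2 * h) < 0) (by linarith : 0 < 2 * h)] using hκ

/-- The slope along parabolas is locally Lipschitz. -/
lemma BurgersMinimizer.exists_lipschitzOnWith_arcSlope (H : BurgersMinimizer Ω v g) (hε : 0 < ε)
    (hΩ : Metric.ball w₀ ε ⊆ Ω) (hv : LipschitzOnWith K v (Metric.ball w₀ ε)) :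
    ∃ δ > (0 : ℝ), ∃ K' : NNReal, LipschitzOnWith K' (arcSlope v) (Metric.ball w₀ δ) := by
  obtain ⟨M, hM0, h, hh, hKh, hM, harc⟩ := H.exists_uniform_arcs hε hΩ hv
  have hslope : ∀ w ∈ Metric.ball w₀ (ε / 2), ∀ x ∈ Icc (-(2 * h)) (2 * h),
        parabolicArc v w (arcSlope v w) x ∈ Metric.ball w₀ ε ∧
          v (parabolicArc v w (arcSlope v w) x) = v w + arcSlope v w * x := by
    intro w hw
    obtain ⟨κ, hκ⟩ := harc w hw
    have hU : Metric.ball w₀ ε ∈ 𝓝 w :=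
      Metric.isOpen_ball.mem_nhds (Metric.ball_subset_ball (by linarith) hw)
    rwa [(hasArcSlope_of_forall_mem_Icc hh fun x hx => (hκ x hx).2).arcSlope_eq hU hv]
  refine ⟨min (ε / 2) (h / 2), by positivity, Real.toNNReal ((1 + 6 * M) * 4 / h ^ 2),
    LipschitzOnWith.of_dist_le_mul fun w hw w' hw' => ?_⟩
  rw [Real.coe_toNNReal _ (by positivity)]
  have hw2 := Metric.ball_subset_ball (min_le_left _ _) hw
  have hw2' := Metric.ball_subset_ball (min_le_left _ _) hw'
  have hdist : dist w w' < h := by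
    have h1 := Metric.mem_ball.1 (Metric.ball_subset_ball (min_le_right _ _) hw)
    have h2 := Metric.mem_ball'.1 (Metric.ball_subset_ball (min_le_right _ _) hw')
    linarith [dist_triangle w w₀ w']
  have hs := hslope w hw2
  have hs' := hslope w' hw2'
  set κ := arcSlope v w with hκ
  set κ' := arcSlope v w' with hκ'
  set x := w'.1 - w.1 with hx
  have hxd : |x| ≤ dist w w' := by
    rw [Prod.dist_eq, Real.dist_eq, abs_sub_comm]; exact le_max_left _ _
  have htd : |w.2 - w'.2| ≤ dist w w' := by
    rw [Prod.dist_eq, Real.dist_eq, Real.dist_eq]; exact le_max_right _ _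
  have hxh := abs_le.1 (hxd.trans hdist.le)
  have hκM : |κ| * h ≤ M := by
    have h1 := hs (2 * h) ⟨by linarith, le_rfl⟩
    have h2 := hM _ h1.1
    have h3 := hM w (Metric.ball_subset_ball (by linarith) hw2)
    rw [h1.2] at h2
    have h4 : |κ * (2 * h)| ≤ M + M := by
      have : κ * (2 * h) = v w + κ * (2 * h) - v w := by ring
      rw [this]
      exact (abs_sub _ _).trans (add_le_add h2 h3)
    rw [abs_mul, abs_of_pos (by linarith : 0 < 2 * h)] at h4
    linarith
  obtain ⟨-, hvz⟩ := hs x ⟨by linarith [hxh.1], by linarith [hxh.2]⟩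
  set t₁ := w.2 - 4 * v w * x - 2 * κ * x ^ 2 with ht₁
  have ez : parabolicArc v w κ x = (w'.1, t₁) := by
    simp only [parabolicArc, hx, ht₁, add_sub_cancel]
  rw [ez] at hvz
  have hshift : ∀ s ∈ Icc 0 h, (w'.1 + s, t₁ - 4 * v (w'.1, t₁) * s - 2 * κ * s ^ 2) ∈
      Metric.ball w₀ ε ∧
      v (w'.1 + s, t₁ - 4 * v (w'.1, t₁) * s - 2 * κ * s ^ 2) = v (w'.1, t₁) + κ * s := by
    intro s hsI
    have h1 := hs (x + s) ⟨by linarith [hxh.1, hsI.1], by linarith [hxh.2, hsI.2]⟩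
    have e : parabolicArc v w κ (x + s) =
        (w'.1 + s, t₁ - 4 * v (w'.1, t₁) * s - 2 * κ * s ^ 2) := by
      rw [hvz]
      simp only [parabolicArc, ht₁, hx]
      ext
      · simp only; ring
      · simp only; ring
    rw [e] at h1
    refine ⟨h1.1, ?_⟩
    rw [h1.2, hvz]; ring
  have hpair : ∀ s ∈ ({h / 2, 2 * (h / 2)} : Set ℝ), s ∈ Icc 0 h := by
    rintro s (rfl | rfl) <;> constructor <;> linarith
  have hicc : ∀ s ∈ Icc 0 h, s ∈ Icc (-(2 * h)) (2 * h) := fun s hs =>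
    ⟨by linarith [hs.1], by linarith [hs.2]⟩
  have key := arc_data_le (v := v) (y := w'.1) (t₁ := t₁) (t₂ := w'.2) (κ₁ := κ) (κ₂ := κ')
    (half_pos hh) K.coe_nonneg (by linarith [mul_nonneg K.coe_nonneg hh.le])
    (fun s hsp => by
      have h1 := hv.dist_le_mul _ (hshift s (hpair s hsp)).1 _ (hs' s (hicc s (hpair s hsp))).1
      rw [Prod.dist_eq] at h1
      simp only [parabolicArc, dist_self, Real.dist_eq] at h1
      rwa [max_eq_right (abs_nonneg _)] at h1)
    (fun s hsp => (hshift s (hpair s hsp)).2) (fun s hsp => (hs' s (hicc s (hpair s hsp))).2)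
  have h1 : |t₁ - w'.2| ≤ (1 + 6 * M) * dist w w' := by
    have e : t₁ - w'.2 = (w.2 - w'.2) - 4 * v w * x - 2 * κ * x * x := by rw [ht₁]; ring
    rw [e]
    refine (abs_sub _ _).trans ?_
    have h2 := abs_sub (w.2 - w'.2) (4 * v w * x)
    rw [abs_mul, abs_mul] at h2
    rw [abs_mul, abs_mul, abs_mul]
    norm_num at h2 ⊢
    have h3 := hM w (Metric.ball_subset_ball (by linarith) hw2)
    have h4 : |v w| * |x| ≤ M * dist w w' := by gcongr
    have h5 : |κ| * |x| ≤ |κ| * h := by gcongr; exact hxd.trans hdist.le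
    have h6 : |κ| * |x| * |x| ≤ M * dist w w' := by gcongr; linarith
    linarith
  have h2 : |κ - κ'| * (h / 2) ≤ (1 + 6 * M) * dist w w' / (h / 2) := by
    refine le_trans ?_ (key.trans (by gcongr))
    linarith [abs_nonneg (v (w'.1, t₁) - v (w'.1, w'.2))]
  rw [Real.dist_eq]
  rw [le_div_iff₀ (half_pos hh)] at h2
  rw [div_mul_eq_mul_div, le_div_iff₀ (by positivity)]
  linarith

/-- The intrinsic gradient agrees with the slope along parabolas. -/
lemma BurgersMinimizer.ae_eq_arcSlope (H : BurgersMinimizer Ω v g) (hε : 0 < ε)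
    (hΩ : Metric.ball w₀ ε ⊆ Ω) (hv : LipschitzOnWith K v (Metric.ball w₀ ε)) :
    ∀ᵐ w, w ∈ Metric.ball w₀ (ε / 2) → g w = arcSlope v w := by
  obtain ⟨M, hM0, h, hh, -, hM, harc⟩ := H.exists_uniform_arcs hε hΩ hv
  obtain ⟨V, hV, hVM, hVv⟩ := hv.exists_bounded_extension hM0 hM
  filter_upwards [H.ae_eq_burgers Metric.isOpen_ball hΩ hV hVv hVM,
    hV.ae_differentiableAt (μ := volume)] with w hw hD hwU
  obtain ⟨κ, hκ⟩ := harc w hwU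
  have hwU' := Metric.ball_subset_ball (by linarith : ε / 2 ≤ ε) hwU
  have hU : Metric.ball w₀ ε ∈ 𝓝 w := Metric.isOpen_ball.mem_nhds hwU'
  have hs := hasArcSlope_of_forall_mem_Icc hh fun x hx => (hκ x hx).2
  rw [hs.arcSlope_eq hU hv, hw hwU', hD.lineDeriv_eq_fderiv, hD.lineDeriv_eq_fderiv]
  have h1 : HasDerivAt (fun x => V (parabolicArc v w κ x)) (fderiv ℝ V w (1, -4 * v w)) 0 := by
    refine HasFDerivAt.comp_hasDerivAt 0 ?_ hasDerivAt_parabolicArc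
    rw [parabolicArc_zero]
    exact hD.hasFDerivAt
  have h2 : HasDerivAt (fun x => V (parabolicArc v w κ x)) κ 0 := by
    have e : HasDerivAt (fun x => v w + κ * x) κ 0 :=
      (((hasDerivAt_id (0:ℝ)).const_mul κ).const_add (v w)).congr_deriv (mul_one κ)
    refine e.congr_of_eventuallyEq ?_
    filter_upwards [hs, eventually_parabolicArc_mem hU (v := v) (κ := κ)] with x h3 h4
    rw [hVv _ h4, h3]
  rw [← h1.unique h2, hVv w hwU']
  have : ((1, -4 * v w) : ℝ × ℝ) = (1, 0) + (-4 * v w) • (0, 1) := by simp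
  rw [this, map_add, map_smul, smul_eq_mul]
  ring

/-- The graph of `v` contains a horizontal segment through each of its points. -/
lemma graphMap_add_smul {s : ℝ} (h : v (parabolicArc v w κ s) = v w + κ * s) :
    graphMap v w + s • (κ, (1 : ℝ), 2 * w.1 * κ - 2 * v w) =
      graphMap v (parabolicArc v w κ s) := by
  simp only [graphMap, h]
  simp only [parabolicArc, Prod.smul_mk, Prod.mk_add_mk, smul_eq_mul, Prod.mk.injEq]
  refine ⟨by ring, by ring, by ring⟩

end

/-- regularity of minimizers of the intrinsic area. A continuous
minimizer with bounded distributional Burgers derivative satisfying the smallness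
condition (ii) is locally Lipschitz, of class `C^{1,1}_{H,loc}`, and its intrinsic
graph is foliated by horizontal straight segments. -/
theorem stmt_19 (Ω : Set (ℝ × ℝ)) (hΩ : IsOpen Ω)
    (v : ℝ × ℝ → ℝ) (hv : ContinuousOn v Ω)
    (g : ℝ × ℝ → ℝ)
    (hg_meas : AEStronglyMeasurable g (volume.restrict Ω))
    (hg_loc : ∀ K : Set (ℝ × ℝ), IsCompact K → K ⊆ Ω →
      ∃ M : ℝ, ∀ᵐ w ∂(volume.restrict K), |g w| ≤ M)
    (hg_dist : ∀ ψ : ℝ × ℝ → ℝ, ContDiff ℝ (⊤ : ℕ∞) ψ → HasCompactSupport ψ →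
      tsupport ψ ⊆ Ω →
      ∫ w in Ω, g w * ψ w =
        -∫ w in Ω, (v w * fderiv ℝ ψ w (1, 0) - 2 * (v w) ^ 2 * fderiv ℝ ψ w (0, 1)))
    -- (i) v minimizes the intrinsic area for compact perturbations
    (hmin : ∀ vt gt : ℝ × ℝ → ℝ, ContinuousOn vt Ω →
      AEStronglyMeasurable gt (volume.restrict Ω) →
      (∀ K : Set (ℝ × ℝ), IsCompact K → K ⊆ Ω →
        ∃ M : ℝ, ∀ᵐ w ∂(volume.restrict K), |gt w| ≤ M) →
      (∀ ψ : ℝ × ℝ → ℝ, ContDiff ℝ (⊤ : ℕ∞) ψ → HasCompactSupport ψ →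
        tsupport ψ ⊆ Ω →
        ∫ w in Ω, gt w * ψ w =
          -∫ w in Ω,
            (vt w * fderiv ℝ ψ w (1, 0) - 2 * (vt w) ^ 2 * fderiv ℝ ψ w (0, 1))) →
      IsCompact (closure (Function.support fun w => v w - vt w)) →
      closure (Function.support fun w => v w - vt w) ⊆ Ω →
      ∀ K : Set (ℝ × ℝ), IsCompact K → K ⊆ Ω →
        (Function.support fun w => v w - vt w) ⊆ K →
        ∫ w in K, Real.sqrt (1 + (g w) ^ 2) ≤ ∫ w in K, Real.sqrt (1 + (gt w) ^ 2))
    -- (ii) the smallness condition: lim_{ρ→0⁺} ρ·ℓ^v_r(ρ;w₀) = 0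
    (hsmall : ∀ w₀ ∈ Ω, ∃ r > (0:ℝ), Metric.closedBall w₀ r ⊆ Ω ∧
      ∀ ε > (0:ℝ), ∃ ρ₀ : ℝ, 0 < ρ₀ ∧ ρ₀ < r ∧ ∀ ρ : ℝ, 0 < ρ → ρ < ρ₀ →
        ∃ L : NNReal, ρ * (L : ℝ) ≤ ε ∧
          LipschitzOnWith L v
            ({w ∈ Metric.ball w₀ r | w₀.1 < w.1} \ lensDr w₀ r ρ) ∧
          LipschitzOnWith L v
            ({w ∈ Metric.ball w₀ r | w.1 < w₀.1} \ lensDr w₀ r ρ)) :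
    -- v is locally Lipschitz in Ω
    (∀ w ∈ Ω, ∃ ε > (0:ℝ), ∃ K : NNReal,
      Metric.ball w ε ⊆ Ω ∧ LipschitzOnWith K v (Metric.ball w ε)) ∧
    -- v ∈ C^{1,1}_{H,loc}(Ω): Bv = g agrees a.e. with a locally Lipschitz function
    (∃ gl : ℝ × ℝ → ℝ,
      (∀ w ∈ Ω, ∃ ε > (0:ℝ), ∃ K : NNReal,
        LipschitzOnWith K gl (Metric.ball w ε ∩ Ω)) ∧
      ∀ᵐ w ∂(volume.restrict Ω), g w = gl w) ∧
    -- S_v is foliated by horizontal straight segments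
    (∀ w ∈ Ω, ∃ d : ℝ × ℝ × ℝ, d ≠ 0 ∧
      d.2.2 = 2 * w.1 * d.1 - 2 * v w * d.2.1 ∧
      ∃ δ > (0:ℝ), ∀ s ∈ Set.Ioo (-δ) δ,
        graphMap v w + s • d ∈ graphMap v '' Ω) := by
  have H : BurgersMinimizer Ω v g := ⟨hΩ, hv, hg_meas, hg_loc, hg_dist, hmin⟩
  have hloc : ∀ w ∈ Ω, ∃ ε > (0 : ℝ), ∃ K : NNReal,
      Metric.ball w ε ⊆ Ω ∧ LipschitzOnWith K v (Metric.ball w ε) := by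
    intro w hw
    obtain ⟨r, hr0, hr, hs⟩ := hsmall w hw
    exact H.exists_lipschitzOnWith_ball hr0 hr hs
  refine ⟨hloc, ⟨arcSlope v, fun w hw => ?_, ?_⟩, fun w hw => ?_⟩
  · obtain ⟨ε, hε, K, hb, hK⟩ := hloc w hw
    obtain ⟨δ, hδ, K', hK'⟩ := H.exists_lipschitzOnWith_arcSlope hε hb hK
    exact ⟨δ, hδ, K', hK'.mono inter_subset_left⟩
  · rw [ae_restrict_iff' hΩ.measurableSet, ae_iff]
    refine measure_null_of_locally_null _ fun w hw => ?_
    simp only [mem_ofPred_eq, Classical.not_imp] at hw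
    obtain ⟨ε, hε, K, hb, hK⟩ := hloc w hw.1
    have hae := H.ae_eq_arcSlope hε hb hK
    rw [ae_iff] at hae
    refine ⟨_, inter_mem self_mem_nhdsWithin
      (mem_nhdsWithin_of_mem_nhds (Metric.ball_mem_nhds w (half_pos hε))),
      measure_mono_null (fun z hz => ?_) hae⟩
    have h1 := hz.1
    simp only [mem_ofPred_eq, Classical.not_imp] at h1 ⊢
    exact ⟨hz.2, h1.2⟩
  · obtain ⟨ε, hε, K, hb, hK⟩ := hloc w hw
    obtain ⟨-, -, h, hh, -, -, harc⟩ := H.exists_uniform_arcs hε hb hK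
    obtain ⟨κ, hκ⟩ := harc w (Metric.mem_ball_self (half_pos hε))
    refine ⟨(κ, 1, 2 * w.1 * κ - 2 * v w), fun h0 => ?_, by simp, h, hh, fun s hs => ?_⟩
    · simp [Prod.ext_iff] at h0
    · obtain ⟨hmem, heq⟩ := hκ s ⟨by linarith [hs.1], by linarith [hs.2]⟩
      exact ⟨_, hb hmem, (graphMap_add_smul heq).symm⟩
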